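/- arXiv:1202.3940 — 2 statements merged into one kernel-verified Lean document; each statement's English description precedes it below -/
import Mathlib

section
/- Let 𝔽 be an algebraically closed field of characteristic zero, let u_1,…,u_m be distinct vectors in V spanning a subspace on which the restriction of the bilinear form is nondegenerate, let a_1,…,a_m ∈ 𝔽 be nonzero, and define h ∈ R* by h(p) = Σ_{i=1}^m a_i p(u_i). Then for every e ≥ 3m, the O_n-orbit of h_e is Zariski-closed. -/
/-!
Formalization framework for "Partition functions of vertex models /
edge connection matrices" (Regts–Draisma style).

Graphs and fragments are finite multigraphs (allowing multiple edges, loops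
and circles); a `k`-fragment additionally has `k` labelled open ends.  We
encode a `k`-fragment by a number `nv` of internal vertices, a number `ne`
of edges, and for each edge the multiset of its endpoints, each endpoint
being either an internal vertex (`Sum.inl`) or an open-end label
(`Sum.inr`).  Every edge has `2` endpoints (counted with multiplicity; a
loop at `v` lists `v` twice) or `0` endpoints (a circle), and every label
occurs exactly once in total (the open ends have degree one).
-/

open MvPolynomial

namespace VertexModels

noncomputable section

/-- A `k`-fragment. For `k = 0` this is a graph. -/
structure Fragment (k : ℕ) : Type where
  nv : ℕ
  ne : ℕ
  inc : Fin ne → Multiset (Fin nv ⊕ Fin k)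
  card_inc : ∀ e, Multiset.card (inc e) = 2 ∨ Multiset.card (inc e) = 0
  openEnd : ∀ j : Fin k, (∑ e, (inc e).count (Sum.inr j)) = 1

/-- A graph: a `0`-fragment. -/
abbrev Graph := Fragment 0

/-- The basic `k`-fragment `F_k`: one internal vertex joined to each of the
`k` open ends by a half edge. -/
def basicFragment (k : ℕ) : Fragment k where
  nv := 1
  ne := k
  inc := fun e => {Sum.inl 0, Sum.inr e}
  card_inc := fun e => Or.inl (by simp)
  openEnd := fun j => by
    have h : ∀ e : Fin k,
        Multiset.count (Sum.inr j) ({Sum.inl 0, Sum.inr e} : Multiset (Fin 1 ⊕ Fin k))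
          = if j = e then 1 else 0 := by
      intro e
      by_cases he : j = e <;>
        simp [Multiset.count_cons, Multiset.count_singleton, he]
    simp only [h]
    simp

variable {𝔽 : Type} [Field 𝔽] {n : ℕ}

/-- A vertex model: a linear functional on `R = 𝔽[x_1, …, x_n]`. -/
abbrev VertexModel (𝔽 : Type) [Field 𝔽] (n : ℕ) : Type :=
  MvPolynomial (Fin n) 𝔽 →ₗ[𝔽] 𝔽

/-- The monomial `∏_{e ∈ δ(v)} x_{ψ(e)}` seen by the internal vertex `v` of a
fragment under the edge colouring `ψ`. -/
def monomialAt {k : ℕ} (F : Fragment k) (ψ : Fin F.ne → Fin n) (v : Fin F.nv) :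
    MvPolynomial (Fin n) 𝔽 :=
  ∏ e, (X (ψ e) : MvPolynomial (Fin n) 𝔽) ^ ((F.inc e).count (Sum.inl v))

/-- The partition function `f_h` of the vertex model `h`. -/
def partitionFun (h : VertexModel 𝔽 n) (G : Graph) : 𝔽 :=
  ∑ ψ : Fin G.ne → Fin n, ∏ v, h (monomialAt G ψ v)

/-- `h_φ(F)`, for a `k`-fragment `F` and a colouring `φ` of the open ends. -/
def hphi (h : VertexModel 𝔽 n) {k : ℕ} (F : Fragment k) (φ : Fin k → Fin n) : 𝔽 :=
  ∑ ψ ∈ Finset.univ.filter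
      (fun ψ : Fin F.ne → Fin n => ∀ (e : Fin F.ne) (j : Fin k),
        Sum.inr j ∈ F.inc e → ψ e = φ j),
    ∏ v, h (monomialAt F ψ v)

/-- `V^{⊗ k}` in coordinates: functions on multi-indices, with basis
`e_φ`. -/
abbrev Tensor (𝔽 : Type) [Field 𝔽] (n k : ℕ) : Type := (Fin k → Fin n) → 𝔽

/-- The tensor `p_h(F) = ∑_φ h_φ(F) e_φ ∈ V^{⊗ k}`. -/
def ph (h : VertexModel 𝔽 n) {k : ℕ} (F : Fragment k) : Tensor 𝔽 n k :=
  fun φ => hphi h F φ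

/-- The standard bilinear form on `V^{⊗ k}`. -/
def tpair {k : ℕ} (t s : Tensor 𝔽 n k) : 𝔽 := ∑ φ, t φ * s φ

/-- Tensor product `V^{⊗ k} × V^{⊗ l} → V^{⊗ (k+l)}`. -/
def tmul {k l : ℕ} (t : Tensor 𝔽 n k) (s : Tensor 𝔽 n l) : Tensor 𝔽 n (k + l) :=
  fun φ => t (fun i => φ (Fin.castAdd l i)) * s (fun i => φ (Fin.natAdd k i))

/-- The contraction `C^k_{i,j} : V^{⊗ k} → V^{⊗ (k-2)}` (here `k = m + 2`),
contracting the `i`-th and `j`-th tensor factors (`i < j`). -/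
def tcontract {m : ℕ} (i j : Fin (m + 2)) (t : Tensor 𝔽 n (m + 2)) : Tensor 𝔽 n m :=
  fun φ => ∑ c : Fin n,
    t (Fin.insertNth i c (Fin.insertNth (⟨j.1 - 1, by have := j.isLt; omega⟩ : Fin (m + 1)) c φ))

/-- The orthogonal group `O_n`, as the set of matrices `g` with `gᵀ g = 1`. -/
def orthSet (𝔽 : Type) [Field 𝔽] (n : ℕ) : Set (Matrix (Fin n) (Fin n) 𝔽) :=
  {g | g.transpose * g = 1}

/-- Substitution `X i ↦ ∑ j, g i j • X j`, i.e. composition of a polynomial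
with the linear map `g`, as a linear endomorphism of `R`. -/
noncomputable def polSub (g : Matrix (Fin n) (Fin n) 𝔽) :
    MvPolynomial (Fin n) 𝔽 →ₗ[𝔽] MvPolynomial (Fin n) 𝔽 :=
  (MvPolynomial.aeval (fun i => ∑ j, MvPolynomial.C (g i j) * X j)).toLinearMap

/-- The action of `g ∈ O_n` on vertex models: `(g h)(p) = h (p ∘ g) = h(g⁻¹ • p)`. -/
noncomputable def dualAct (g : Matrix (Fin n) (Fin n) 𝔽) (h : VertexModel 𝔽 n) :
    VertexModel 𝔽 n :=
  h.comp (polSub g)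

/-- The stabilizer `Stab(h) = {g ∈ O_n ∣ g h = h}`. -/
noncomputable def Stab (h : VertexModel 𝔽 n) : Set (Matrix (Fin n) (Fin n) 𝔽) :=
  {g | g ∈ orthSet 𝔽 n ∧ dualAct g h = h}

/-- The diagonal action of a matrix `g` on `V^{⊗ k}`. -/
def tact (g : Matrix (Fin n) (Fin n) 𝔽) (k : ℕ) :
    Tensor 𝔽 n k →ₗ[𝔽] Tensor 𝔽 n k :=
  Matrix.mulVecLin (Matrix.of fun φ ψ : Fin k → Fin n => ∏ i, g (φ i) (ψ i))

/-- The subspace `(V^{⊗ k})^S` of tensors fixed by every element of a set `S`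
of matrices. -/
def invSub (S : Set (Matrix (Fin n) (Fin n) 𝔽)) (k : ℕ) :
    Submodule 𝔽 (Tensor 𝔽 n k) where
  carrier := {t | ∀ g ∈ S, tact g k t = t}
  add_mem' := fun {a b} ha hb => by
    intro g hg
    rw [map_add, ha g hg, hb g hg]
  zero_mem' := by
    intro g hg
    rw [map_zero]
  smul_mem' := fun c a ha => by
    intro g hg
    rw [map_smul, ha g hg]

/-! ### Gluing two `k`-fragments into a graph -/

/-- `touches F H j a`: the edge `a` of the disjoint union of `F` and `H` is
incident with the open end labelled `j` (of its own fragment). -/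
def touches {k : ℕ} (F H : Fragment k) (j : Fin k) : Fin F.ne ⊕ Fin H.ne → Prop
  | .inl e => Sum.inr j ∈ F.inc e
  | .inr e => Sum.inr j ∈ H.inc e

/-- Edges of `F` and `H` which get merged into a single edge of `F * H` are
identified by the equivalence generated by sharing an open-end label. -/
def glueSetoid {k : ℕ} (F H : Fragment k) : Setoid (Fin F.ne ⊕ Fin H.ne) :=
  Relation.EqvGen.setoid (fun a b => ∃ j, touches F H j a ∧ touches F H j b)

/-- Number of edges of the glued graph `F * H`. -/
noncomputable def glueNE {k : ℕ} (F H : Fragment k) : ℕ :=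
  Nat.card (Quotient (glueSetoid F H))

noncomputable def glueEquiv {k : ℕ} (F H : Fragment k) :
    Fin (glueNE F H) ≃ Quotient (glueSetoid F H) :=
  (Finite.equivFin _).symm

/-- The internal (non-open-end) endpoints of an edge of the disjoint union,
re-indexed in `Fin (F.nv + H.nv)`. -/
def intEnds {k : ℕ} (F H : Fragment k) :
    Fin F.ne ⊕ Fin H.ne → Multiset (Fin (F.nv + H.nv) ⊕ Fin 0)
  | .inl e => (F.inc e).filterMap fun x =>
      match x with
      | .inl v => some (Sum.inl (Fin.castAdd H.nv v))
      | .inr _ => none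
  | .inr e => (H.inc e).filterMap fun x =>
      match x with
      | .inl v => some (Sum.inl (Fin.natAdd F.nv v))
      | .inr _ => none

/-- Endpoints of an edge of the glued graph: the internal endpoints of all
edges merged into it. -/
noncomputable def glueInc {k : ℕ} (F H : Fragment k) (c : Fin (glueNE F H)) :
    Multiset (Fin (F.nv + H.nv) ⊕ Fin 0) := by
  classical
  exact ∑ a ∈ Finset.univ.filter
    (fun a => Quotient.mk (glueSetoid F H) a = glueEquiv F H c), intEnds F H a

/-- The glued graph `F * H` of two `k`-fragments: connect the half edges
with equally labelled open ends into single edges (chains of half edges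
closing up produce circles).  (The impossible degenerate branch is never
taken.) -/
noncomputable def glue {k : ℕ} (F H : Fragment k) : Graph := by
  classical
  exact if hc : ∀ c, Multiset.card (glueInc F H c) = 2 ∨ Multiset.card (glueInc F H c) = 0 then
    { nv := F.nv + H.nv
      ne := glueNE F H
      inc := glueInc F H
      card_inc := hc
      openEnd := fun j => j.elim0 }
  else basicFragment 0

/-- The rank of the edge connection matrix `M_{f_h,k}` : the dimension of the
span of its rows. -/
noncomputable def connectionRank (h : VertexModel 𝔽 n) (k : ℕ) : ℕ :=
  Module.finrank 𝔽 (Submodule.span 𝔽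
    (Set.range fun F : Fragment k => fun H : Fragment k => partitionFun h (glue F H)))

/-! ### The algebra `𝒜` of formal linear combinations of fragments -/

/-- `p_h` on formal linear combinations `𝔽ℱ_k` of `k`-fragments. -/
noncomputable def phL (h : VertexModel 𝔽 n) (k : ℕ) :
    (Fragment k →₀ 𝔽) →ₗ[𝔽] Tensor 𝔽 n k :=
  Finsupp.linearCombination 𝔽 (fun F : Fragment k => ph h F)

/-- `γ ↦ (F ↦ f_h(γ * F))`: the bilinear extension of gluing followed by the
partition function.  Its kernel is `I_k`. -/
noncomputable def glueRow (h : VertexModel 𝔽 n) (k : ℕ) :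
    (Fragment k →₀ 𝔽) →ₗ[𝔽] (Fragment k → 𝔽) :=
  Finsupp.linearCombination 𝔽
    (fun F : Fragment k => fun H : Fragment k => partitionFun h (glue F H))

/-- A vertex model is nondegenerate if `ker p_h = I`. -/
def Nondeg (h : VertexModel 𝔽 n) : Prop :=
  ∀ (k : ℕ) (γ : Fragment k →₀ 𝔽), phL h k γ = 0 ↔ glueRow h k γ = 0

/-! ### The product of fragments and the contraction of fragments -/

/-- Endpoint multisets of the disjoint union `F H` of fragments (`H`'s open
ends relabelled by `i ↦ k + i`). -/
def mulInc {k l : ℕ} (F : Fragment k) (H : Fragment l) :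
    Fin (F.ne + H.ne) → Multiset (Fin (F.nv + H.nv) ⊕ Fin (k + l)) :=
  Fin.addCases
    (fun e => (F.inc e).map (Sum.map (Fin.castAdd H.nv) (Fin.castAdd l)))
    (fun e => (H.inc e).map (Sum.map (Fin.natAdd F.nv) (Fin.natAdd k)))

/-- The product `F H` in the fragment algebra `𝒜`: disjoint union, with the
open ends of `H` relabelled `i ↦ k + i`.  (The impossible degenerate branch
is never taken.) -/
noncomputable def fragMul {k l : ℕ} (F : Fragment k) (H : Fragment l) :
    Fragment (k + l) := by
  classical
  exact if hc : (∀ e, Multiset.card (mulInc F H e) = 2 ∨ Multiset.card (mulInc F H e) = 0)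
      ∧ (∀ j : Fin (k + l), (∑ e, (mulInc F H e).count (Sum.inr j)) = 1) then
    { nv := F.nv + H.nv
      ne := F.ne + H.ne
      inc := mulInc F H
      card_inc := hc.1
      openEnd := hc.2 }
  else basicFragment (k + l)

/-- Relabelling map for labels after removing labels `i` and `j` (`i < j`),
preserving the order of the remaining labels. -/
def downLabel {m : ℕ} (i j l : Fin (m + 2)) (hij : i < j) (h : ¬(l = i ∨ l = j)) : Fin m :=
  ⟨l.1 - (if i.1 < l.1 then 1 else 0) - (if j.1 < l.1 then 1 else 0), by
    push_neg at h
    have h1 : l.1 ≠ i.1 := fun hh => h.1 (Fin.ext hh)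
    have h2 : l.1 ≠ j.1 := fun hh => h.2 (Fin.ext hh)
    have h3 : i.1 < j.1 := hij
    have h4 := l.isLt
    have h6 := j.isLt
    split_ifs <;> omega⟩

/-- Removing the open ends `i` and `j` from an endpoint multiset and
relabelling the remaining open ends. -/
def removeEnd {m nv : ℕ} (i j : Fin (m + 2)) (hij : i < j) :
    Fin nv ⊕ Fin (m + 2) → Option (Fin nv ⊕ Fin m)
  | .inl v => some (.inl v)
  | .inr l => if h : l = i ∨ l = j then none else some (.inr (downLabel i j l hij h))

/-- Edges merged by the contraction `Γ^k_{i,j}`: those incident with the open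
end `i` or the open end `j`. -/
def contractSetoid {m : ℕ} (F : Fragment (m + 2)) (i j : Fin (m + 2)) :
    Setoid (Fin F.ne) :=
  Relation.EqvGen.setoid (fun e e' =>
    (Sum.inr i ∈ F.inc e ∨ Sum.inr j ∈ F.inc e) ∧
    (Sum.inr i ∈ F.inc e' ∨ Sum.inr j ∈ F.inc e'))

noncomputable def contractNE {m : ℕ} (F : Fragment (m + 2)) (i j : Fin (m + 2)) : ℕ :=
  Nat.card (Quotient (contractSetoid F i j))

noncomputable def contractEquiv {m : ℕ} (F : Fragment (m + 2)) (i j : Fin (m + 2)) :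
    Fin (contractNE F i j) ≃ Quotient (contractSetoid F i j) :=
  (Finite.equivFin _).symm

noncomputable def contractInc {m : ℕ} (F : Fragment (m + 2)) (i j : Fin (m + 2))
    (hij : i < j) (c : Fin (contractNE F i j)) : Multiset (Fin F.nv ⊕ Fin m) := by
  classical
  exact ∑ e ∈ Finset.univ.filter
    (fun e => Quotient.mk (contractSetoid F i j) e = contractEquiv F i j c),
    (F.inc e).filterMap (removeEnd i j hij)

/-- The contraction `Γ^k_{i,j}(F)` of a `(m+2)`-fragment: join the half edges
at the open ends labelled `i` and `j` into a single edge (possibly a circle)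
and relabel the remaining open ends preserving their order.  (The impossible
degenerate branch is never taken.) -/
noncomputable def fragContract {m : ℕ} (i j : Fin (m + 2)) (hij : i < j)
    (F : Fragment (m + 2)) : Fragment m := by
  classical
  exact if hc : (∀ c, Multiset.card (contractInc F i j hij c) = 2 ∨
        Multiset.card (contractInc F i j hij c) = 0)
      ∧ (∀ jj : Fin m, (∑ c, (contractInc F i j hij c).count (Sum.inr jj)) = 1) then
    { nv := F.nv
      ne := contractNE F i j
      inc := contractInc F i j hij
      card_inc := hc.1
      openEnd := hc.2 }
  else basicFragment m

/-! ### Zariski closedness, spin models, reductivity -/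

/-- A subset of a coordinate space `ι → 𝔽` is Zariski closed if it is the
common zero locus of a set of polynomials. -/
def IsZarClosed {ι : Type} (S : Set (ι → 𝔽)) : Prop :=
  ∃ P : Set (MvPolynomial ι 𝔽), S = {x | ∀ p ∈ P, MvPolynomial.eval x p = 0}

/-- The vertex model `h(p) = ∑ i, a i • p (u i)` attached to points
`u_1, …, u_m` and coefficients `a_1, …, a_m`. -/
noncomputable def spinModel {m : ℕ} (u : Fin m → (Fin n → 𝔽)) (a : Fin m → 𝔽) :
    VertexModel 𝔽 n :=
  ∑ i, a i • (MvPolynomial.aeval (u i) : MvPolynomial (Fin n) 𝔽 →ₐ[𝔽] 𝔽).toLinearMap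

/-- Multi-degrees of total degree at most `e`: coordinates for the space
`(R_{≤ e})^*`. -/
def LowDeg (n e : ℕ) : Type := {d : Fin n →₀ ℕ // (d.sum fun _ c => c) ≤ e}

/-- The `O_n`-orbit of `h_e` (the restriction of `h` to polynomials of degree
at most `e`), in coordinates. -/
noncomputable def restOrbit (h : VertexModel 𝔽 n) (e : ℕ) : Set (LowDeg n e → 𝔽) :=
  {y | ∃ g ∈ orthSet 𝔽 n, ∀ d : LowDeg n e,
    y d = dualAct g h (MvPolynomial.monomial d.1 (1 : 𝔽))}

/-- The `O_n`-orbit of an `m`-tuple of vectors, in coordinates. -/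
def vecOrbit {m : ℕ} (u : Fin m → (Fin n → 𝔽)) : Set (Fin m × Fin n → 𝔽) :=
  {y | ∃ g ∈ orthSet 𝔽 n, ∀ p : Fin m × Fin n, y p = g.mulVec (u p.1) p.2}

/-- The `O_n`-orbit of an element `w` of `⊕_{k ≤ e} V^{⊗ k}`, in
coordinates. -/
def tensorTupleOrbit (e : ℕ) (w : ∀ k : ℕ, Tensor 𝔽 n k) :
    Set ((Σ p : Fin (e + 1), (Fin p.1 → Fin n)) → 𝔽) :=
  {y | ∃ g ∈ orthSet 𝔽 n, ∀ q : Σ p : Fin (e + 1), (Fin p.1 → Fin n),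
    y q = tact g q.1 (w q.1) q.2}

/-- Linear reductivity of a set `H` of `n × n` matrices: in every
polynomial representation of `H`, every `H`-invariant subspace admits an
`H`-invariant complement. -/
def IsLinRed (H : Set (Matrix (Fin n) (Fin n) 𝔽)) : Prop :=
  ∀ (m : ℕ) (ρ : Matrix (Fin n) (Fin n) 𝔽 → Matrix (Fin m) (Fin m) 𝔽),
    (∀ a b : Fin m, ∃ p : MvPolynomial (Fin n × Fin n) 𝔽,
      ∀ g, ρ g a b = MvPolynomial.eval (fun q => g q.1 q.2) p) →
    (∀ g ∈ H, ∀ g' ∈ H, ρ (g * g') = ρ g * ρ g') → ρ 1 = 1 →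
    ∀ W : Submodule 𝔽 (Fin m → 𝔽),
      (∀ g ∈ H, ∀ w ∈ W, (ρ g).mulVec w ∈ W) →
      ∃ W' : Submodule 𝔽 (Fin m → 𝔽), IsCompl W W' ∧
        (∀ g ∈ H, ∀ w ∈ W', (ρ g).mulVec w ∈ W')

/-- The pointwise stabilizer in `O_n` of a graded family of subspaces of the
tensor algebra. -/
def setStab (A : ∀ k : ℕ, Submodule 𝔽 (Tensor 𝔽 n k)) :
    Set (Matrix (Fin n) (Fin n) 𝔽) :=
  {g | g ∈ orthSet 𝔽 n ∧ ∀ (k : ℕ), ∀ a ∈ A k, tact g k a = a}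

/-- The sum of the nontrivial `H`-isotypic components of `V^{⊗ k}`: the
largest `H`-stable subspace meeting the invariants trivially. -/
def nontrivialPart (H : Set (Matrix (Fin n) (Fin n) 𝔽)) (k : ℕ) :
    Submodule 𝔽 (Tensor 𝔽 n k) :=
  sSup {W | (∀ g ∈ H, ∀ w ∈ W, tact g k w ∈ W) ∧ W ⊓ invSub H k = ⊥}

end

end VertexModels

open VertexModels

/-- A proper ideal containing the kernel of a map to a field is dominated by a valuation ring of
that field. -/
theorem exists_valuationSubring_of_ker_le {B K : Type*} [CommRing B] [Field K] (f : B →+* K)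
    {I : Ideal B} (hI : I ≠ ⊤) (hf : RingHom.ker f ≤ I) :
    ∃ V : ValuationSubring K, (∀ b, f b ∈ V) ∧ ∀ b ∈ I, f b ∈ V.nonunits := by
  have hJ : I.map f.rangeRestrict ≠ ⊤ := by
    intro h
    apply hI
    have := congrArg (Ideal.comap f.rangeRestrict) h
    rw [Ideal.comap_map_of_surjective _ f.rangeRestrict_surjective, Ideal.comap_top] at this
    rw [← this, eq_comm, sup_eq_left]
    intro x hx
    apply hf
    simpa [Subtype.ext_iff] using hx
  obtain ⟨V, hV, hV'⟩ := Ideal.image_subset_nonunits_valuationSubring _ hJ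
  exact ⟨V, fun b => hV ⟨b, rfl⟩, fun b hb =>
    hV' ⟨f.rangeRestrict b, Ideal.mem_map_of_mem _ hb, rfl⟩⟩

/-- Some linear form with coefficients in an infinite field of constants attains the maximal
valuation of the coordinates on each of finitely many vectors. -/
theorem exists_generic_linear_form {F K Γ : Type*} [Field F] [Infinite F] [Field K] [Algebra F K]
    [LinearOrderedCommGroupWithZero Γ] (val : Valuation K Γ)
    (hval : ∀ c : F, val (algebraMap F K c) ≤ 1)
    {ι σ : Type*} [Finite ι] [Fintype σ] (w : ι → σ → K) :
    ∃ s : σ → F, ∀ t l, val (w t l) ≤ val (∑ k, algebraMap F K (s k) * w t k) := by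
  classical
  let p : {q : ι × σ // w q.1 q.2 ≠ 0} → Submodule F (σ → F) := fun q =>
    { carrier := {s | val (∑ k, algebraMap F K (s k) * w q.1.1 k) < val (w q.1.1 q.1.2)}
      add_mem' := by
        intro a b ha hb
        simp only [Set.mem_ofPred_eq, Pi.add_apply, map_add, add_mul, Finset.sum_add_distrib] at *
        exact val.map_add_lt ha hb
      zero_mem' := by simpa [zero_lt_iff] using q.2
      smul_mem' := by
        intro c a ha
        simp only [Set.mem_ofPred_eq, Pi.smul_apply, smul_eq_mul, map_mul, mul_assoc,
          ← Finset.mul_sum] at *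
        exact lt_of_le_of_lt (mul_le_of_le_one_left' (hval c)) ha }
  have hp : ∀ q, p q ≠ ⊤ := by
    intro q hq
    have : Pi.single q.1.2 1 ∈ p q := hq ▸ Submodule.mem_top
    change val _ < _ at this
    simp [Pi.single_apply] at this
  have hcov : ⋃ q, (p q : Set (σ → F)) ≠ Set.univ := fun h =>
    (Subspace.exists_eq_top_of_iUnion_eq_univ h).elim hp
  obtain ⟨s, hs⟩ := (Set.ne_univ_iff_exists_notMem _).1 hcov
  refine ⟨s, fun t l => ?_⟩
  by_cases h : w t l = 0
  · simp [h]
  · by_contra hlt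
    exact hs (Set.mem_iUnion.2 ⟨⟨(t, l), h⟩, not_le.1 hlt⟩)

theorem eval₂_sum_mem {K : Type*} [Field K] (V : ValuationSubring K) {ι : Type*} [Fintype ι]
    (a x : ι → K) (N : ℕ) (hS : ∀ r ≤ N, ∑ i, a i * x i ^ r ∈ V)
    (q : Polynomial V) (hq : q.natDegree ≤ N) :
    ∑ i, a i * q.eval₂ V.subtype (x i) ∈ V := by
  simp_rw [Polynomial.eval₂_eq_sum_range, Finset.mul_sum]
  rw [Finset.sum_comm]
  refine sum_mem fun r hr => ?_
  have : ∑ i, a i * (V.subtype (q.coeff r) * x i ^ r)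
      = V.subtype (q.coeff r) * ∑ i, a i * x i ^ r := by
    rw [Finset.mul_sum]; exact Finset.sum_congr rfl fun _ _ => by ring
  rw [this]
  exact V.mul_mem _ _ (q.coeff r).2 (hS r (by have := Finset.mem_range.1 hr; omega))

/-- If the weighted power sums of `x` of order at most `3m` are integral, then the weight of a
point of maximal, nonintegral valuation that is not too close to the others has valuation less
than one. -/
theorem valuation_lt_one_of_powerSums_mem {K : Type*} [Field K] (V : ValuationSubring K)
    {ι : Type*} [Fintype ι] (a x : ι → K) (z : K) (hz : 1 < V.valuation z) (i₀ : ι)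
    (hx : ∀ i, V.valuation (x i) ≤ V.valuation z) (hx₀ : V.valuation z ≤ V.valuation (x i₀))
    (hsep : ∀ i, i ≠ i₀ → 1 ≤ V.valuation (x i₀ - x i) * V.valuation z)
    (hS : ∀ r ≤ 3 * Fintype.card ι, ∑ i, a i * x i ^ r ∈ V) :
    V.valuation (a i₀) < 1 := by
  classical
  have hz0 : z ≠ 0 := by rintro rfl; simp at hz
  have hzV : V.valuation z ≠ 0 := (Valuation.ne_zero_iff _).2 hz0
  obtain ⟨α, hα⟩ : ∃ α : V, (α : K) = z⁻¹ := by
    refine ⟨⟨z⁻¹, ?_⟩, rfl⟩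
    rw [← V.valuation_le_one_iff, map_inv₀]
    exact inv_le_one_of_one_le₀ hz.le
  have hβ : ∀ i, ∃ β : V, (β : K) = z⁻¹ * x i := fun i => by
    refine ⟨⟨z⁻¹ * x i, ?_⟩, rfl⟩
    rw [← V.valuation_le_one_iff, map_mul, map_inv₀]
    exact inv_mul_le_one_of_le₀ (hx i) zero_le
  choose β hβ using hβ
  let L : ι → Polynomial V := fun j =>
    Polynomial.X ^ 2 * (Polynomial.C α * Polynomial.X - Polynomial.C (β j))
  have hL : ∀ j, (L j).natDegree ≤ 3 := fun j => by
    simp only [L]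
    compute_degree
  let q : Polynomial V := Polynomial.X ^ 2 * ∏ j ∈ Finset.univ.erase i₀, L j
  have hq : q.natDegree ≤ 3 * Fintype.card ι := by
    have h1 : (∏ j ∈ Finset.univ.erase i₀, L j).natDegree ≤ ∑ _j ∈ Finset.univ.erase i₀, 3 :=
      (Polynomial.natDegree_prod_le _ _).trans (Finset.sum_le_sum fun j _ => hL j)
    have h2 : q.natDegree ≤ 2 + _ :=
      Polynomial.natDegree_mul_le_of_le (Polynomial.natDegree_X_pow_le 2) h1
    have h3 : 0 < Fintype.card ι := Fintype.card_pos_iff.2 ⟨i₀⟩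
    simp [Finset.card_erase_of_mem] at h2
    omega
  have heval : ∀ i, q.eval₂ V.subtype (x i) = x i ^ 2 * ∏ j ∈ Finset.univ.erase i₀,
      (x i ^ 2 * (z⁻¹ * (x i - x j))) := fun i => by
    simp [q, L, Polynomial.eval₂_finsetProd, hα, hβ, mul_sub]
    exact Or.inl (Finset.prod_congr rfl fun _ _ => by ring)
  have hsum := eval₂_sum_mem V a x _ hS q hq
  rw [Finset.sum_eq_single i₀, ← V.valuation_le_one_iff, map_mul] at hsum
  · have hlt : 1 < V.valuation (q.eval₂ V.subtype (x i₀)) := by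
      rw [heval, map_mul, map_pow, map_prod]
      have h1 : 1 < V.valuation (x i₀) := hz.trans_le hx₀
      refine (one_lt_pow₀ h1 two_ne_zero).trans_le
        (le_mul_of_one_le_right' (Finset.one_le_prod' fun j hj => ?_))
      rw [map_mul, map_mul, map_pow, map_inv₀, le_antisymm (hx i₀) hx₀]
      have := hsep j (Finset.ne_of_mem_erase hj)
      convert this using 1
      field_simp
    by_contra hge
    exact absurd hsum (not_le.2 (hlt.trans_le (le_mul_of_one_le_left' (not_lt.1 hge))))
  · intro i _ hi
    rw [heval, Finset.prod_eq_zero (Finset.mem_erase.2 ⟨hi, Finset.mem_univ i⟩) (by simp)]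
    simp
  · simp

/-- If the moments up to degree `3m` of a combination of `m` points are integral, and the points
are separated by constant nonzero inner products, then the points have integral coordinates. -/
theorem coords_mem_of_spinModel_mem {F K : Type*} [Field F] [Infinite F] [Field K] [Algebra F K]
    (V : ValuationSubring K) (hF : ∀ c : F, algebraMap F K c ∈ V) {ι σ : Type*} [Fintype ι]
    [Fintype σ] (a : ι → F) (ha : ∀ i, a i ≠ 0) (v : ι → σ → K)
    (hsep : ∀ i k, i ≠ k → ∃ j, ∃ c : F, c ≠ 0 ∧
      (v i - v k) ⬝ᵥ v j = algebraMap F K c)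
    (hsum : ∀ p : MvPolynomial σ F, p.totalDegree ≤ 3 * Fintype.card ι →
      ∑ i, algebraMap F K (a i) * aeval (v i) p ∈ V) (i : ι) (l : σ) : v i l ∈ V := by
  classical
  have hF1 : ∀ c : F, c ≠ 0 → V.valuation (algebraMap F K c) = 1 := by
    intro c hc
    apply le_antisymm ((V.valuation_le_one_iff _).2 (hF c))
    have := (V.valuation_le_one_iff _).2 (hF c⁻¹)
    rw [map_inv₀, map_inv₀] at this
    by_contra hlt
    have h0 : V.valuation (algebraMap F K c) ≠ 0 := by simpa using hc
    exact absurd this (not_le.2 ((one_lt_inv₀ (zero_lt_iff.2 h0)).2 (not_le.1 hlt)))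
  obtain ⟨⟨i₀, l₀⟩, -, hmax⟩ := Finset.exists_max_image Finset.univ
    (fun q : ι × σ => V.valuation (v q.1 q.2)) ⟨(i, l), Finset.mem_univ _⟩
  by_contra hil
  have hz : 1 < V.valuation (v i₀ l₀) :=
    (not_le.1 (mt (V.valuation_le_one_iff _).1 hil)).trans_le (hmax (i, l) (Finset.mem_univ _))
  obtain ⟨s, hs⟩ := exists_generic_linear_form V.valuation
    (fun c => (V.valuation_le_one_iff _).2 (hF c))
    (Sum.elim v fun q : ι × ι => v q.1 - v q.2)
  have hlt := valuation_lt_one_of_powerSums_mem V (fun i => algebraMap F K (a i))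
    (fun i => ∑ k, algebraMap F K (s k) * v i k) (v i₀ l₀) hz i₀ (fun i => ?_)
    (hs (Sum.inl i₀) l₀) (fun i hi => ?_) (fun r hr => ?_)
  · exact hlt.ne (hF1 _ (ha i₀))
  · refine V.valuation.map_sum_le fun k _ => ?_
    rw [map_mul]
    exact (mul_le_of_le_one_left' ((V.valuation_le_one_iff _).2 (hF _))).trans
      (hmax (i, k) (Finset.mem_univ _))
  · obtain ⟨j, c, hc, hj⟩ := hsep i₀ i hi.symm
    rw [← hF1 c hc, ← hj, ← Finset.sum_sub_distrib]
    simp_rw [← mul_sub]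
    refine V.valuation.map_sum_le fun k _ => ?_
    rw [map_mul]
    exact mul_le_mul' (hs (Sum.inr (i₀, i)) k) (hmax (j, k) (Finset.mem_univ _))
  · have := hsum ((∑ k, C (s k) * X k) ^ r) ?_
    · simpa [MvPolynomial.algebraMap_eq] using this
    · refine (totalDegree_pow _ _).trans ?_
      refine le_trans (Nat.mul_le_mul_left r (totalDegree_finsetSum_le fun k _ => ?_))
        ((mul_one r).trans_le hr)
      refine (totalDegree_mul _ _).trans ?_
      simp

/-- A valuative criterion: if integrality of the pulled back functions forces integrality of the
coordinates on `Z`, then every point in the closure of the image of `Z` is the image of a point of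
the closure of `Z`. -/
theorem exists_point_of_valuative {F : Type} [Field F] [IsAlgClosed F] {τ : Type} [Finite τ]
    {B : Type} [CommRing B] [Algebra F B] (θ : B →ₐ[F] MvPolynomial τ F) (Z : Set (τ → F))
    (y : B →ₐ[F] F) (hy : ∀ b, (∀ x ∈ Z, aeval x (θ b) = 0) → y b = 0)
    (hval : ∀ (K : Type) [Field K] [Algebra F K] (ψ : MvPolynomial τ F →ₐ[F] K)
      (V : ValuationSubring K), (∀ p ∈ vanishingIdeal F Z, ψ p = 0) → (∀ b, ψ (θ b) ∈ V) →
      ∀ t, ψ (X t) ∈ V) :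
    ∃ x : τ → F, (∀ p ∈ vanishingIdeal F Z, aeval x p = 0) ∧ ∀ b, aeval x (θ b) = y b := by
  have hm : (RingHom.ker y).IsPrime := RingHom.ker_isPrime y
  obtain ⟨Q, hQ, hZQ, hdisj⟩ := Ideal.exists_le_prime_disjoint (vanishingIdeal F Z)
    ((RingHom.ker y).primeCompl.map (θ : B →* MvPolynomial τ F)) (by
      rw [Set.disjoint_left]
      rintro _ hb ⟨b, hb', rfl⟩
      exact hb' (hy b (mem_vanishingIdeal_iff.1 hb)))
  let K := FractionRing (MvPolynomial τ F ⧸ Q)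
  let ψ : MvPolynomial τ F →ₐ[F] K :=
    (IsScalarTower.toAlgHom F (MvPolynomial τ F ⧸ Q) K).comp (Ideal.Quotient.mkₐ F Q)
  have hψ : ∀ p, ψ p = 0 ↔ p ∈ Q := fun p => by
    simp only [ψ, AlgHom.comp_apply, IsScalarTower.coe_toAlgHom', Ideal.Quotient.mkₐ_eq_mk,
      FaithfulSMul.algebraMap_eq_zero_iff, Ideal.Quotient.eq_zero_iff_mem]
  obtain ⟨V, hV, hV'⟩ := exists_valuationSubring_of_ker_le ((ψ.comp θ : B →ₐ[F] K) : B →+* K)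
    hm.ne_top (fun b hb => by
      by_contra hb'
      exact Set.disjoint_left.1 hdisj ((hψ _).1 hb) ⟨b, hb', rfl⟩)
  have hX := hval K ψ V (fun p hp => (hψ p).2 (hZQ hp)) hV
  have hS : ∀ p, ψ p ∈ V := fun p => by
    induction p using MvPolynomial.induction_on with
    | C c => simpa using hV (algebraMap F B c)
    | add p q hp hq => rw [map_add]; exact add_mem hp hq
    | mul_X p t hp => rw [map_mul]; exact mul_mem hp (hX t)
  let ψV : MvPolynomial τ F →+* V := (ψ : MvPolynomial τ F →+* K).codRestrict V.toSubring hS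
  obtain ⟨M, hM, hle⟩ := Ideal.exists_le_maximal
    ((IsLocalRing.maximalIdeal V).comap ψV) (Ideal.IsPrime.ne_top inferInstance)
  obtain ⟨x, rfl⟩ := isMaximal_iff_eq_vanishingIdeal_singleton.1 hM
  have hx : ∀ p, V.valuation (ψ p) < 1 → aeval x p = 0 := fun p hp => by
    refine (mem_vanishingIdeal_singleton_iff _ _).1 (hle ?_)
    exact (V.valuation_lt_one_iff (ψV p)).2 hp
  refine ⟨x, fun p hp => hx p (by simp [(hψ p).2 (hZQ hp)]), fun b => ?_⟩
  have := hx (θ (b - algebraMap F B (y b))) (V.mem_nonunits_iff.1 (hV' _ (by simp)))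
  simpa [sub_eq_zero] using this

theorem exists_orthonormal_basis_of_nondegenerate {F W : Type*} [Field F] [IsAlgClosed F]
    [NeZero (2 : F)] [AddCommGroup W] [Module F W] [FiniteDimensional F W]
    {B : LinearMap.BilinForm F W} (hB : LinearMap.IsSymm B) (hnd : B.Nondegenerate) :
    ∃ b : Module.Basis (Fin (Module.finrank F W)) F W,
      ∀ i j, B (b i) (b j) = if i = j then 1 else 0 := by
  let _ : Invertible (2 : F) := invertibleOfNonzero (NeZero.ne _)
  obtain ⟨v, hv⟩ := LinearMap.BilinForm.exists_orthogonal_basis hB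
  have h0 := LinearMap.BilinForm.iIsOrtho.not_isOrtho_basis_self_of_nondegenerate hv hnd
  have hs : ∀ i, ∃ c : F, c ^ 2 = B (v i) (v i) := fun i =>
    IsAlgClosed.exists_pow_nat_eq _ two_pos
  choose c hc using hs
  have hc0 : ∀ i, c i ≠ 0 := fun i h => h0 i (by simp [← hc, h])
  refine ⟨v.unitsSMul fun i => (Units.mk0 (c i) (hc0 i))⁻¹, fun i j => ?_⟩
  simp only [Module.Basis.unitsSMul_apply, Units.smul_def, map_smul, LinearMap.smul_apply,
    smul_eq_mul]
  split_ifs with hij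
  · subst hij
    have := hc0 i
    simp [← hc]
    field_simp
  · have : B (v i) (v j) = 0 := hv hij
    simp [this]

theorem exists_isometry_of_finrank_eq {F W W' : Type*} [Field F] [IsAlgClosed F]
    [NeZero (2 : F)] [AddCommGroup W] [Module F W] [FiniteDimensional F W]
    [AddCommGroup W'] [Module F W'] [FiniteDimensional F W']
    {B : LinearMap.BilinForm F W} (hB : LinearMap.IsSymm B) (hnd : B.Nondegenerate)
    {B' : LinearMap.BilinForm F W'} (hB' : LinearMap.IsSymm B') (hnd' : B'.Nondegenerate)
    (h : Module.finrank F W = Module.finrank F W') :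
    ∃ T : W →ₗ[F] W', ∀ x y, B' (T x) (T y) = B x y := by
  obtain ⟨b, hb⟩ := exists_orthonormal_basis_of_nondegenerate hB hnd
  obtain ⟨b', hb'⟩ := exists_orthonormal_basis_of_nondegenerate hB' hnd'
  refine ⟨b.constr F fun i => b' (finCongr h i), fun x y => ?_⟩
  have : B'.compl₁₂ (b.constr F fun i => b' (finCongr h i)) (b.constr F fun i => b' (finCongr h i))
      = B := by
    refine LinearMap.BilinForm.ext_basis b fun i j => ?_
    rw [LinearMap.compl₁₂_apply, b.constr_basis, b.constr_basis, hb, hb']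
    simp [Fin.ext_iff]
  exact LinearMap.congr_fun₂ this x y

/-- Witt's extension theorem for isometric embeddings of nondegenerate subspaces. -/
theorem exists_isometry_extending {F V : Type*} [Field F] [IsAlgClosed F]
    [NeZero (2 : F)] [AddCommGroup V] [Module F V] [FiniteDimensional F V]
    {B : LinearMap.BilinForm F V} (hB : LinearMap.IsSymm B) (hnd : B.Nondegenerate)
    {U : Submodule F V} (hU : ∀ x ∈ U, (∀ y ∈ U, B x y = 0) → x = 0)
    (L : U →ₗ[F] V) (hL : ∀ x y : U, B (L x) (L y) = B x y) :
    ∃ g : V →ₗ[F] V, (∀ x y, B (g x) (g y) = B x y) ∧ ∀ x : U, g x = L x := by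
  have hR : B.IsRefl := hB.isRefl
  have key : ∀ U : Submodule F V, (∀ x ∈ U, (∀ y ∈ U, B x y = 0) → x = 0) →
      IsCompl U (B.orthogonal U) ∧ (B.restrict (B.orthogonal U)).Nondegenerate := by
    intro U hU
    have hd : Disjoint U (B.orthogonal U) := by
      rw [Submodule.disjoint_def]
      intro x hx hx'
      exact hU x hx fun y hy => hR _ _ (LinearMap.BilinForm.mem_orthogonal_iff.1 hx' y hy)
    refine ⟨(LinearMap.BilinForm.isCompl_orthogonal_iff_disjoint hR).2 hd,
      B.nondegenerate_restrict_of_disjoint_orthogonal hR ?_⟩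
    rw [LinearMap.BilinForm.orthogonal_orthogonal hnd hR]
    exact hd.symm
  have hLinj : Function.Injective L := by
    rw [injective_iff_map_eq_zero]
    intro x hx
    exact Subtype.ext (hU x x.2 fun y hy => by rw [← hL x ⟨y, hy⟩, hx]; simp)
  obtain ⟨hC, hC'⟩ := key U hU
  obtain ⟨-, hD'⟩ := key (LinearMap.range L) (by
    rintro _ ⟨x, rfl⟩ h
    have : x = 0 := Subtype.ext (hU x x.2 fun y hy => by
      rw [← hL x ⟨y, hy⟩]; exact h _ ⟨_, rfl⟩)
    simp [this])
  obtain ⟨T, hT⟩ := exists_isometry_of_finrank_eq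
    (B := B.restrict _) ⟨fun x y => hB.eq x y⟩ hC'
    (B' := B.restrict _) ⟨fun x y => hB.eq x y⟩ hD' (by
      rw [LinearMap.BilinForm.finrank_orthogonal hnd, LinearMap.BilinForm.finrank_orthogonal hnd,
        LinearMap.finrank_range_of_inj hLinj])
  let g := LinearMap.ofIsCompl hC L ((B.orthogonal (LinearMap.range L)).subtype ∘ₗ T)
  have hgU : ∀ x : U, g x = L x := fun x => LinearMap.ofIsCompl_apply_left hC x
  have hgC : ∀ x : B.orthogonal U, g x = T x := fun x => LinearMap.ofIsCompl_apply_right hC x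
  refine ⟨g, fun x y => ?_, hgU⟩
  obtain ⟨x₁, x₂, rfl, -⟩ := Submodule.existsUnique_add_of_isCompl hC x
  obtain ⟨y₁, y₂, rfl, -⟩ := Submodule.existsUnique_add_of_isCompl hC y
  have h1 : ∀ (z : U) (w : B.orthogonal U), B z w = 0 := fun z w =>
    LinearMap.BilinForm.mem_orthogonal_iff.1 w.2 z z.2
  have h2 : ∀ (z : U) (w : B.orthogonal U), B (L z) (T w) = 0 := fun z w =>
    LinearMap.BilinForm.mem_orthogonal_iff.1 (T w).2 _ ⟨z, rfl⟩
  have h3 : B (T x₂) (T y₂) = B x₂ y₂ := hT x₂ y₂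
  simp only [map_add, LinearMap.add_apply, hgU, hgC, hL, h1, h2, h3, hR _ _ (h1 _ _),
    hR _ _ (h2 _ _)]

/-- Two tuples of vectors with the same Gram matrix are in one orbit of the orthogonal group if the
first spans a nondegenerate subspace and its linear relations hold for the second. -/
theorem exists_mem_orthSet_of_gram {F : Type} [Field F] [IsAlgClosed F] [NeZero (2 : F)]
    {n m : ℕ} {u v : Fin m → Fin n → F}
    (hnd : ∀ x ∈ Submodule.span F (Set.range u),
      (∀ y ∈ Submodule.span F (Set.range u), (∑ i, x i * y i) = 0) → x = 0)
    (hgram : ∀ i j, v i ⬝ᵥ v j = u i ⬝ᵥ u j)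
    (hrel : ∀ c : Fin m → F, ∑ i, c i • u i = 0 → ∑ i, c i • v i = 0) :
    ∃ g ∈ orthSet F n, ∀ i, g.mulVec (u i) = v i := by
  let B : LinearMap.BilinForm F (Fin n → F) := dotProductBilin F F
  have hBapp : ∀ x y, B x y = x ⬝ᵥ y := fun _ _ => rfl
  have hB : LinearMap.IsSymm B := ⟨fun x y => dotProduct_comm x y⟩
  have hBnd : B.Nondegenerate :=
    ⟨fun x hx => dotProduct_eq_zero x hx,
      fun y hy => dotProduct_eq_zero y fun x => (dotProduct_comm y x).trans (hy x)⟩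
  let p := Fintype.linearCombination F u
  let q := Fintype.linearCombination F v
  have hpq : LinearMap.ker p ≤ LinearMap.ker q := fun c hc => hrel c hc
  obtain ⟨f, hf⟩ : ∃ f : (Fin n → F) →ₗ[F] (Fin n → F), f ∘ₗ p = q := by
    obtain ⟨f, hf⟩ := LinearMap.exists_extend
      ((LinearMap.ker p).liftQ q hpq ∘ₗ p.quotKerEquivRange.symm.toLinearMap)
    refine ⟨f, LinearMap.ext fun c => ?_⟩
    refine (LinearMap.congr_fun hf ⟨p c, LinearMap.mem_range_self p c⟩).trans ?_
    rw [LinearMap.comp_apply, LinearEquiv.coe_coe, LinearMap.quotKerEquivRange_symm_apply_image,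
      Submodule.mkQ_apply, Submodule.liftQ_apply]
  have hfu : ∀ i, f (u i) = v i := fun i => by
    simpa [p, q] using LinearMap.congr_fun hf (Pi.single i 1)
  have hiso : B.compl₁₂ q q = B.compl₁₂ p p := by
    refine LinearMap.BilinForm.ext_basis (Pi.basisFun F (Fin m)) fun i j => ?_
    simpa [p, q, hBapp] using hgram i j
  have hU : ∀ x ∈ Submodule.span F (Set.range u), ∃ c, p c = x := fun x hx => by
    rwa [← Fintype.range_linearCombination] at hx
  obtain ⟨g, hg, hgu⟩ := exists_isometry_extending hB hBnd hnd
    (f.domRestrict (Submodule.span F (Set.range u))) (by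
      rintro ⟨x, hx⟩ ⟨y, hy⟩
      obtain ⟨c, rfl⟩ := hU x hx
      obtain ⟨d, rfl⟩ := hU y hy
      have h1 := LinearMap.congr_fun₂ hiso c d
      simpa [← hf] using h1)
  refine ⟨LinearMap.toMatrix' g, ?_, fun i => ?_⟩
  · ext i j
    have := hg (Pi.single i 1) (Pi.single j 1)
    simp only [hBapp] at this
    simpa [Matrix.mul_apply, Matrix.transpose_apply, LinearMap.toMatrix'_apply, dotProduct,
      Matrix.one_apply, Pi.single_apply, eq_comm] using this
  · rw [LinearMap.toMatrix'_mulVec]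
    exact (hgu ⟨u i, Submodule.subset_span ⟨i, rfl⟩⟩).trans (hfu i)

theorem spinModel_apply {F : Type} [Field F] {n m : ℕ} (u : Fin m → Fin n → F) (a : Fin m → F)
    (p : MvPolynomial (Fin n) F) : spinModel u a p = ∑ i, a i * aeval (u i) p := by
  simp [spinModel]

theorem dualAct_spinModel {F : Type} [Field F] {n m : ℕ} (g : Matrix (Fin n) (Fin n) F)
    (u : Fin m → Fin n → F) (a : Fin m → F) :
    dualAct g (spinModel u a) = spinModel (fun i => g.mulVec (u i)) a := by
  refine LinearMap.ext fun p => ?_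
  simp only [dualAct, polSub, LinearMap.comp_apply, spinModel_apply, AlgHom.toLinearMap_apply,
    comp_aeval_apply]
  simp only [map_sum, map_mul, aeval_C, aeval_X]
  rfl

theorem gram_eq_of_mem_orthSet {F : Type} [Field F] {n : ℕ} {g : Matrix (Fin n) (Fin n) F}
    (hg : g ∈ orthSet F n) (x y : Fin n → F) : g.mulVec x ⬝ᵥ g.mulVec y = x ⬝ᵥ y := by
  have hg' : g.transpose * g = 1 := hg
  rw [Matrix.dotProduct_mulVec, ← Matrix.mulVec_transpose, Matrix.mulVec_mulVec, hg',
    Matrix.one_mulVec]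

/-- The comorphism of the map sending `m` points of `F ^ n` to their spin model, restricted to
polynomials of degree at most `e`. -/
noncomputable def spinComorphism {F : Type} [Field F] {n m : ℕ} (a : Fin m → F) (e : ℕ) :
    MvPolynomial (LowDeg n e) F →ₐ[F] MvPolynomial (Fin m × Fin n) F :=
  aeval fun d => ∑ i, C (a i) * rename (Prod.mk i) (monomial d.1 1)

theorem exists_spinComorphism_eq {F : Type} [Field F] {n m : ℕ} (a : Fin m → F) {e : ℕ}
    (p : MvPolynomial (Fin n) F) (hp : p.totalDegree ≤ e) :
    ∃ b, spinComorphism (n := n) a e b = ∑ i, C (a i) * rename (Prod.mk i) p := by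
  let L : MvPolynomial (Fin n) F →ₗ[F] MvPolynomial (Fin m × Fin n) F :=
    ∑ i, LinearMap.mulLeft F (C (a i)) ∘ₗ (rename (Prod.mk i)).toLinearMap
  have hL : ∀ q, L q = ∑ i, C (a i) * rename (Prod.mk i) q := fun q => by simp [L]
  refine ⟨∑ d ∈ p.support.attach, p.coeff d.1 •
    (X ⟨d.1, (le_totalDegree d.2).trans hp⟩ : MvPolynomial (LowDeg n e) F), ?_⟩
  have hp' : p = ∑ d ∈ p.support.attach, p.coeff d.1 • monomial d.1 (1 : F) := by
    rw [Finset.sum_attach p.support fun d => p.coeff d • monomial d (1 : F)]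
    simp [smul_monomial]
  rw [← hL, map_sum, congrArg L hp', map_sum]
  refine Finset.sum_congr rfl fun d _ => ?_
  rw [map_smul, map_smul, hL]
  exact congrArg _ (aeval_X _ _)

theorem aeval_spinComorphism {F : Type} [Field F] {n m : ℕ} (a : Fin m → F) (e : ℕ)
    (x : Fin m × Fin n → F) (b : MvPolynomial (LowDeg n e) F) :
    aeval x (spinComorphism (n := n) a e b)
      = eval (fun d => spinModel (fun i l => x (i, l)) a (monomial d.1 1)) b := by
  rw [← aeval_eq_eval, spinComorphism, comp_aeval_apply]
  congr 2
  ext d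
  simp only [spinModel_apply, map_sum, map_mul, aeval_C, aeval_rename]
  rfl

theorem vecOrbit_gram {F : Type} [Field F] {n m : ℕ} (u : Fin m → Fin n → F) (i j : Fin m) :
    (∑ l, X (i, l) * X (j, l) - C (u i ⬝ᵥ u j) : MvPolynomial (Fin m × Fin n) F) ∈
      vanishingIdeal F (vecOrbit u) := by
  rw [mem_vanishingIdeal_iff]
  rintro x ⟨g, hg, hx⟩
  simp only [map_sub, map_sum, map_mul, aeval_X, hx, aeval_C, ← gram_eq_of_mem_orthSet hg (u i)]
  exact sub_self _

theorem vecOrbit_relation {F : Type} [Field F] {n m : ℕ} (u : Fin m → Fin n → F) {c : Fin m → F}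
    (hc : ∑ i, c i • u i = 0) (l : Fin n) :
    (∑ i, C (c i) * X (i, l) : MvPolynomial (Fin m × Fin n) F) ∈
      vanishingIdeal F (vecOrbit u) := by
  rw [mem_vanishingIdeal_iff]
  rintro x ⟨g, hg, hx⟩
  have := congrFun (congrArg g.mulVec hc) l
  simpa [hx, Matrix.mulVec_sum, Matrix.mulVec_smul] using this

theorem exists_dotProduct_ne {F : Type} [Field F] {n m : ℕ} {u : Fin m → Fin n → F}
    (hu : Function.Injective u)
    (hnd : ∀ x ∈ Submodule.span F (Set.range u),
      (∀ y ∈ Submodule.span F (Set.range u), (∑ i, x i * y i) = 0) → x = 0)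
    {i k : Fin m} (hik : i ≠ k) : ∃ j, (u i - u k) ⬝ᵥ u j ≠ 0 := by
  by_contra! h
  refine hik (hu (sub_eq_zero.1 (hnd _ (sub_mem (Submodule.subset_span ⟨i, rfl⟩)
    (Submodule.subset_span ⟨k, rfl⟩)) fun y hy => ?_)))
  change (u i - u k) ⬝ᵥ y = 0
  induction hy using Submodule.span_induction with
  | mem y hy => obtain ⟨j, rfl⟩ := hy; exact h j
  | zero => simp
  | add x y _ _ hx hy => rw [dotProduct_add, hx, hy, add_zero]
  | smul c x _ hx => rw [dotProduct_smul, hx, smul_zero]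


/-- If `u_1, …, u_m` are distinct and span a nondegenerate subspace, and the
`aᵢ` are nonzero, then the `O_n`-orbit of `h_e` is Zariski closed for every
`e ≥ 3m`, where `h(p) = ∑ᵢ aᵢ p(uᵢ)`. -/
theorem spin_model_orbit_closed (𝔽 : Type) [Field 𝔽] [IsAlgClosed 𝔽] [CharZero 𝔽]
    (n m : ℕ) (u : Fin m → (Fin n → 𝔽)) (hu : Function.Injective u)
    (a : Fin m → 𝔽) (ha : ∀ i, a i ≠ 0)
    (hnd : ∀ x ∈ Submodule.span 𝔽 (Set.range u),
      (∀ y ∈ Submodule.span 𝔽 (Set.range u), (∑ i, x i * y i) = 0) → x = 0)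
    (e : ℕ) (he : 3 * m ≤ e) :
    IsZarClosed (restOrbit (spinModel u a) e) := by
  refine ⟨{p | ∀ y ∈ restOrbit (spinModel u a) e, eval y p = 0}, Set.Subset.antisymm
    (fun y hy p hp => hp y hy) fun y hy => ?_⟩
  obtain ⟨x, hxZ, hxy⟩ := exists_point_of_valuative (spinComorphism (n := n) a e) (vecOrbit u)
    (aeval y) (fun b hb => by
      rw [aeval_eq_eval]
      refine hy b ?_
      rintro z ⟨g, hg, hz⟩
      have := hb (fun q => g.mulVec (u q.1) q.2) ⟨g, hg, fun _ => rfl⟩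
      rw [aeval_spinComorphism] at this
      rw [← this]
      congr 2
      funext d
      rw [hz, dualAct_spinModel])
    (fun K _ _ ψ V hψ hV t => by
      refine coords_mem_of_spinModel_mem V (fun c => by simpa using hV (C c)) a ha
        (fun i l => ψ (X (i, l))) (fun i k hik => ?_) (fun p hp => ?_) t.1 t.2
      · obtain ⟨j, hj⟩ := exists_dotProduct_ne hu hnd hik
        have h1 : ∀ i, (fun l => ψ (X (i, l))) ⬝ᵥ (fun l => ψ (X (j, l))) =
            algebraMap 𝔽 K (u i ⬝ᵥ u j) := fun i => by
          have := hψ _ (vecOrbit_gram u i j)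
          rw [map_sub, sub_eq_zero, algHom_C] at this
          rw [← this, map_sum]
          simp only [map_mul]
          rfl
        exact ⟨j, _, hj, by rw [sub_dotProduct, h1, h1, sub_dotProduct, map_sub]⟩
      · obtain ⟨b, hb⟩ := exists_spinComorphism_eq a p (hp.trans (by simpa using he))
        have := hV b
        rw [hb, map_sum] at this
        simp only [map_mul, algHom_C] at this
        convert this using 3 with i
        have h := AlgHom.congr_fun (aeval_unique (ψ.comp (rename (Prod.mk i)))) p
        simpa [Function.comp_def] using h.symm)
  obtain ⟨g, hg, hgu⟩ := exists_mem_orthSet_of_gram (v := fun i l => x (i, l)) hnd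
    (fun i j => by
      have := hxZ _ (vecOrbit_gram u i j)
      simpa [sub_eq_zero, dotProduct] using this)
    (fun c hc => by
      funext l
      have := hxZ _ (vecOrbit_relation u hc l)
      simpa using this)
  refine ⟨g, hg, fun d => ?_⟩
  have := hxy (X d)
  rw [aeval_spinComorphism, eval_X, aeval_X] at this
  rw [← this, dualAct_spinModel]
  simp only [hgu]
end

section
/- Let 𝔽 be an algebraically closed field of characteristic zero, let u_1,…,u_m be distinct vectors spanning V, let a_1,…,a_m ∈ 𝔽 be nonzero, and define the vertex model h ∈ R* by h(p) = Σ_{i=1}^m a_i p(u_i). Let H be the group of all orthogonal transformations g of V such that for each i there is a j with g u_i = u_j and a_j = a_i. Then H is a finite group, and for every k ∈ ℕ the rank of the edge connection matrix M_{f_h,k} equals dim (V^{⊗k})^H. -/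
/-!
Formalization framework for "Partition functions of vertex models /
edge connection matrices" (Regts–Draisma style).

Graphs and fragments are finite multigraphs (allowing multiple edges, loops
and circles); a `k`-fragment additionally has `k` labelled open ends.  We
encode a `k`-fragment by a number `nv` of internal vertices, a number `ne`
of edges, and for each edge the multiset of its endpoints, each endpoint
being either an internal vertex (`Sum.inl`) or an open-end label
(`Sum.inr`).  Every edge has `2` endpoints (counted with multiplicity; a
loop at `v` lists `v` twice) or `0` endpoints (a circle), and every label
occurs exactly once in total (the open ends have degree one).
-/

open MvPolynomial

open VertexModels

namespace VertexModels

section Fragments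

variable {𝔽 : Type} [Field 𝔽] {n k : ℕ}

/-- Every open end lies on exactly one edge. -/
theorem Fragment.exists_labelEdge (F : Fragment k) :
    ∃ l : Fin k → Fin F.ne, ∀ e j, (F.inc e).count (Sum.inr j) = if l j = e then 1 else 0 := by
  have key : ∀ j, ∃ e₀, ∀ e, (F.inc e).count (Sum.inr j) = if e₀ = e then 1 else 0 := by
    intro j
    have h := F.openEnd j
    obtain ⟨e₀, h₀⟩ : ∃ e₀, (F.inc e₀).count (Sum.inr j) ≠ 0 := by
      by_contra! hc
      simp [hc] at h
    refine ⟨e₀, fun e => ?_⟩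
    rw [← Finset.add_sum_erase _ _ (Finset.mem_univ e₀)] at h
    have h2 : ∑ e ∈ Finset.univ.erase e₀, (F.inc e).count (Sum.inr j) = 0 := by omega
    rw [Finset.sum_eq_zero_iff] at h2
    split_ifs with he
    · subst he; omega
    · exact h2 e (by simp [Ne.symm he])
  choose l hl using key
  exact ⟨l, fun e j => hl j e⟩

/-- The edge carrying the open end `j`. -/
noncomputable def Fragment.labelEdge (F : Fragment k) : Fin k → Fin F.ne :=
  F.exists_labelEdge.choose

theorem Fragment.count_inr (F : Fragment k) (e : Fin F.ne) (j : Fin k) :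
    (F.inc e).count (Sum.inr j) = if F.labelEdge j = e then 1 else 0 :=
  F.exists_labelEdge.choose_spec e j

theorem Fragment.inr_mem_inc (F : Fragment k) (e : Fin F.ne) (j : Fin k) :
    Sum.inr j ∈ F.inc e ↔ F.labelEdge j = e := by
  rw [← Multiset.count_ne_zero, F.count_inr]
  simp

theorem hphi_eq_sum_ite (h : VertexModel 𝔽 n) (F : Fragment k) (φ : Fin k → Fin n) :
    hphi h F φ = ∑ χ : Fin F.ne → Fin n,
      if (fun j => χ (F.labelEdge j)) = φ then ∏ v, h (monomialAt F χ v) else 0 := by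
  rw [hphi, Finset.sum_filter]
  refine Finset.sum_congr rfl fun χ _ => ?_
  congr 1
  simp only [F.inr_mem_inc, funext_iff, eq_iff_iff]
  exact ⟨fun hc j => hc _ j rfl, by rintro hc _ j rfl; exact hc j⟩

theorem tpair_ph (h : VertexModel 𝔽 n) (F H : Fragment k) :
    tpair (ph h F) (ph h H) =
      ∑ p : (Fin F.ne → Fin n) × (Fin H.ne → Fin n) with
        (fun j => p.1 (F.labelEdge j)) = fun j => p.2 (H.labelEdge j),
        (∏ v, h (monomialAt F p.1 v)) * ∏ v, h (monomialAt H p.2 v) := by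
  simp only [tpair, ph, hphi_eq_sum_ite, Finset.sum_mul_sum]
  rw [Finset.sum_filter, Fintype.sum_prod_type, Finset.sum_comm]
  refine Finset.sum_congr rfl fun χ _ => ?_
  rw [Finset.sum_comm]
  refine Finset.sum_congr rfl fun χ' _ => ?_
  rw [Finset.sum_eq_single (fun j => χ (F.labelEdge j))]
  · simp [eq_comm]
  · intro φ _ hφ
    rw [if_neg (Ne.symm hφ), zero_mul]
  · simp

/-- A connected component of a multigraph has at most one vertex more than it has edges. -/
theorem card_class_le_card_edges_add_one {X L : Type*} [Fintype X] [Fintype L]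
    [DecidableEq X] (s t : L → X) (r : Setoid X)
    (hst : ∀ j, r (s j) (t j))
    (hr : ∀ T : Set X, (∀ j, s j ∈ T ↔ t j ∈ T) → ∀ x y, r x y → x ∈ T → y ∈ T)
    [DecidableRel r] (x₀ : X) :
    (Finset.univ.filter fun x => r x₀ x).card ≤
      (Finset.univ.filter fun j => r x₀ (s j)).card + 1 := by
  classical
  let good : Finset X → Prop := fun T => x₀ ∈ T ∧ (∀ x ∈ T, r x₀ x) ∧
    ∃ J : Finset L, (∀ j ∈ J, s j ∈ T ∧ t j ∈ T) ∧ T.card ≤ J.card + 1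
  obtain ⟨T, hT, hmax⟩ := Finset.exists_max_image (Finset.univ.filter good) Finset.card
    ⟨{x₀}, by simp only [Finset.mem_filter_univ]
              exact ⟨by simp, by simp, ∅, by simp, by simp⟩⟩
  simp only [Finset.mem_filter_univ] at hT hmax
  obtain ⟨hx₀, hTr, J, hJ, hcard⟩ := hT
  have grow : ∀ j x, x ∉ T → r x₀ x → (∀ T' : Finset X, insert x T = T' → s j ∈ T' ∧ t j ∈ T') →
      j ∉ J → False := by
    intro j x hx hrx hj hjJ
    have := hmax (insert x T) ⟨by simp [hx₀], by
        intro y hy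
        rcases Finset.mem_insert.1 hy with rfl | hy
        exacts [hrx, hTr y hy], insert j J, by
        intro i hi
        rcases Finset.mem_insert.1 hi with rfl | hi
        · exact hj _ rfl
        · exact ⟨Finset.mem_insert_of_mem (hJ i hi).1, Finset.mem_insert_of_mem (hJ i hi).2⟩, by
        rw [Finset.card_insert_of_notMem hx, Finset.card_insert_of_notMem hjJ]; omega⟩
    rw [Finset.card_insert_of_notMem hx] at this
    omega
  have closed : ∀ j, s j ∈ (T : Set X) ↔ t j ∈ (T : Set X) := by
    intro j
    simp only [Finset.mem_coe]
    constructor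
    · intro hs
      by_contra ht
      exact grow j (t j) ht (r.trans (hTr _ hs) (hst j))
        (by rintro _ rfl; simp [hs]) fun hj => ht (hJ j hj).2
    · intro ht
      by_contra hs
      exact grow j (s j) hs (r.trans (hTr _ ht) (r.symm (hst j)))
        (by rintro _ rfl; simp [ht]) fun hj => hs (hJ j hj).1
  have hsub : (Finset.univ.filter fun x => r x₀ x) ⊆ T := by
    intro y hy
    exact hr T closed x₀ y (by simpa using hy) hx₀
  have hsub' : J ⊆ Finset.univ.filter fun j => r x₀ (s j) := by
    intro j hj
    simpa using hTr _ (hJ j hj).1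
  have := Finset.card_le_card hsub
  have := Finset.card_le_card hsub'
  omega

theorem touches_inl (F H : Fragment k) (j : Fin k) (e : Fin F.ne) :
    touches F H j (.inl e) ↔ F.labelEdge j = e := F.inr_mem_inc e j

theorem touches_inr (F H : Fragment k) (j : Fin k) (e : Fin H.ne) :
    touches F H j (.inr e) ↔ H.labelEdge j = e := H.inr_mem_inc e j

theorem glueSetoid_labelEdge (F H : Fragment k) (j : Fin k) :
    glueSetoid F H (.inl (F.labelEdge j)) (.inr (H.labelEdge j)) :=
  Relation.EqvGen.rel _ _ ⟨j, (touches_inl F H j _).2 rfl, (touches_inr F H j _).2 rfl⟩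

theorem glueSetoid_le (F H : Fragment k) (r : Setoid (Fin F.ne ⊕ Fin H.ne))
    (hr : ∀ j, r (.inl (F.labelEdge j)) (.inr (H.labelEdge j))) {x y}
    (hxy : glueSetoid F H x y) : r x y := by
  refine Setoid.eqvGen_le (s := r) ?_ hxy
  rintro (e | e) (e' | e') ⟨j, h, h'⟩ <;>
    simp only [touches_inl, touches_inr] at h h' <;> subst h <;> subst h'
  · exact r.refl _
  · exact hr j
  · exact r.symm (hr j)
  · exact r.refl _

theorem card_inc_eq (F : Fragment k) (e : Fin F.ne) :
    Multiset.card (F.inc e) = (∑ v, (F.inc e).count (Sum.inl v)) +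
      (Finset.univ.filter fun j => F.labelEdge j = e).card := by
  rw [← Multiset.sum_count_eq_card (s := Finset.univ) (by simp), Fintype.sum_sum_type]
  simp [F.count_inr]

theorem count_intEnds_inl (F H : Fragment k) (e : Fin F.ne) (v : Fin F.nv) :
    (intEnds F H (.inl e)).count (.inl (Fin.castAdd H.nv v)) = (F.inc e).count (.inl v) := by
  simp only [intEnds]
  induction F.inc e using Multiset.induction_on with
  | empty => simp
  | cons x s ih =>
    rcases x with w | j
    · rw [Multiset.filterMap_cons_some (b := Sum.inl (Fin.castAdd H.nv w)) _ _ _ (by rfl)]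
      simp [Multiset.count_cons, ih]
    · rw [Multiset.filterMap_cons_none _ _ (by rfl)]
      simp [ih]

theorem count_intEnds_inr (F H : Fragment k) (e : Fin H.ne) (v : Fin H.nv) :
    (intEnds F H (.inr e)).count (.inl (Fin.natAdd F.nv v)) = (H.inc e).count (.inl v) := by
  simp only [intEnds]
  induction H.inc e using Multiset.induction_on with
  | empty => simp
  | cons x s ih =>
    rcases x with w | j
    · rw [Multiset.filterMap_cons_some (b := Sum.inl (Fin.natAdd F.nv w)) _ _ _ (by rfl)]
      simp [Multiset.count_cons, ih]
    · rw [Multiset.filterMap_cons_none _ _ (by rfl)]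
      simp [ih]

theorem count_intEnds_inl_natAdd (F H : Fragment k) (e : Fin F.ne) (v : Fin H.nv) :
    (intEnds F H (.inl e)).count (.inl (Fin.natAdd F.nv v)) = 0 := by
  rw [Multiset.count_eq_zero, intEnds, Multiset.mem_filterMap]
  rintro ⟨w | j, -, h⟩
  · simp only [Option.some.injEq, Sum.inl.injEq, Fin.ext_iff, Fin.val_castAdd,
      Fin.val_natAdd] at h
    omega
  · simp at h

theorem count_intEnds_inr_castAdd (F H : Fragment k) (e : Fin H.ne) (v : Fin F.nv) :
    (intEnds F H (.inr e)).count (.inl (Fin.castAdd H.nv v)) = 0 := by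
  rw [Multiset.count_eq_zero, intEnds, Multiset.mem_filterMap]
  rintro ⟨w | j, -, h⟩
  · simp only [Option.some.injEq, Sum.inl.injEq, Fin.ext_iff, Fin.val_castAdd,
      Fin.val_natAdd] at h
    omega
  · simp at h

theorem card_intEnds (F H : Fragment k) (x : Fin F.ne ⊕ Fin H.ne) :
    ∃ c, (c = 2 ∨ c = 0) ∧ c = Multiset.card (intEnds F H x) +
      ((Finset.univ.filter fun j => Sum.inl (F.labelEdge j) = x).card +
      (Finset.univ.filter fun j => Sum.inr (H.labelEdge j) = x).card) := by
  rw [← Multiset.sum_count_eq_card (s := Finset.univ) (by simp), Fintype.sum_sum_type,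
    Fin.sum_univ_add]
  rcases x with e | e
  · refine ⟨_, F.card_inc e, ?_⟩
    rw [card_inc_eq]
    simp [count_intEnds_inl, count_intEnds_inl_natAdd]
  · refine ⟨_, H.card_inc e, ?_⟩
    rw [card_inc_eq]
    simp [count_intEnds_inr, count_intEnds_inr_castAdd]

theorem card_glueInc (F H : Fragment k) (c : Fin (glueNE F H)) :
    Multiset.card (glueInc F H c) = 2 ∨ Multiset.card (glueInc F H c) = 0 := by
  classical
  obtain ⟨x₀, hx₀⟩ := Quotient.exists_rep (glueEquiv F H c)
  have hcls : ∀ x, Quotient.mk (glueSetoid F H) x = glueEquiv F H c ↔ glueSetoid F H x₀ x := by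
    intro x
    rw [← hx₀, eq_comm]
    exact Quotient.eq
  have hle := card_class_le_card_edges_add_one (fun j => Sum.inl (F.labelEdge j))
    (fun j => Sum.inr (H.labelEdge j)) (glueSetoid F H) (glueSetoid_labelEdge F H) (by
      intro T hT x y hxy hx
      have := glueSetoid_le F H (Setoid.ker (· ∈ T)) (fun j => propext (hT j)) hxy
      exact (iff_of_eq this).1 hx) x₀
  choose d hd hd' using card_intEnds F H
  set C := Finset.univ.filter fun x => glueSetoid F H x₀ x with hC
  have hsum : ∑ x ∈ C, d x = Multiset.card (glueInc F H c) +
      2 * (Finset.univ.filter fun j => glueSetoid F H x₀ (.inl (F.labelEdge j))).card := by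
    have h1 : (∑ x ∈ C, (Finset.univ.filter fun j => Sum.inl (F.labelEdge j) = x).card) =
        (Finset.univ.filter fun j => glueSetoid F H x₀ (.inl (F.labelEdge j))).card := by
      rw [Finset.card_eq_sum_card_fiberwise (f := fun j => Sum.inl (F.labelEdge j)) (t := C)]
      · refine Finset.sum_congr rfl fun x hx => ?_
        congr 1
        ext j
        simp only [Finset.mem_filter, Finset.mem_univ, true_and, hC] at hx ⊢
        exact ⟨fun h => ⟨h ▸ hx, h⟩, fun h => h.2⟩
      · intro j hj
        simpa [hC] using hj
    have h2 : (∑ x ∈ C, (Finset.univ.filter fun j => Sum.inr (H.labelEdge j) = x).card) =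
        (Finset.univ.filter fun j => glueSetoid F H x₀ (.inl (F.labelEdge j))).card := by
      have hrel : ∀ j, glueSetoid F H x₀ (.inl (F.labelEdge j)) ↔
          glueSetoid F H x₀ (.inr (H.labelEdge j)) := fun j =>
        ⟨fun h => (glueSetoid F H).trans h (glueSetoid_labelEdge F H j),
          fun h => (glueSetoid F H).trans h ((glueSetoid F H).symm (glueSetoid_labelEdge F H j))⟩
      simp only [hrel]
      rw [Finset.card_eq_sum_card_fiberwise (f := fun j => Sum.inr (H.labelEdge j)) (t := C)]
      · refine Finset.sum_congr rfl fun x hx => ?_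
        congr 1
        ext j
        simp only [Finset.mem_filter, Finset.mem_univ, true_and, hC] at hx ⊢
        exact ⟨fun h => ⟨h ▸ hx, h⟩, fun h => h.2⟩
      · intro j hj
        simpa [hC] using hj
    have h3 : Multiset.card (glueInc F H c) = ∑ x ∈ C, Multiset.card (intEnds F H x) := by
      simp only [glueInc, hcls, Multiset.card_sum]
      congr!
    simp only [hd', Finset.sum_add_distrib, h1, h2, h3]
    ring
  have hle2 : ∑ x ∈ C, d x ≤ 2 * C.card := by
    rw [mul_comm]
    exact Finset.sum_le_card_nsmul _ _ _ fun x _ => by rcases hd x with h | h <;> omega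
  have heven : 2 ∣ ∑ x ∈ C, d x :=
    Finset.dvd_sum fun x _ => by rcases hd x with h | h <;> omega
  omega

theorem count_glueInc (F H : Fragment k) (c : Fin (glueNE F H))
    (v : Fin (F.nv + H.nv) ⊕ Fin 0) [DecidableEq (Quotient (glueSetoid F H))] :
    (glueInc F H c).count v = ∑ x, if Quotient.mk (glueSetoid F H) x = glueEquiv F H c then
      (intEnds F H x).count v else 0 := by
  simp only [glueInc, Multiset.count_sum', Finset.sum_filter]
  refine Finset.sum_congr rfl fun x _ => ?_
  split_ifs <;> simp

theorem prod_pow_count_glueInc {M : Type*} [CommMonoid M] (F H : Fragment k)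
    (f : Fin (glueNE F H) → M) (v : Fin (F.nv + H.nv) ⊕ Fin 0) :
    ∏ c, f c ^ (glueInc F H c).count v =
      ∏ x, f ((glueEquiv F H).symm (Quotient.mk _ x)) ^ (intEnds F H x).count v := by
  classical
  simp only [count_glueInc, ← Finset.prod_pow_eq_pow_sum]
  rw [Finset.prod_comm]
  refine Finset.prod_congr rfl fun x _ => ?_
  rw [Finset.prod_eq_single ((glueEquiv F H).symm (Quotient.mk _ x))]
  · simp
  · intro c _ hc
    rw [if_neg, pow_zero]
    intro h
    exact hc (by rw [h, Equiv.symm_apply_apply])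
  · simp

/-- Gluing fragments corresponds to pairing the associated tensors. -/
theorem partitionFun_glue (h : VertexModel 𝔽 n) (F H : Fragment k) :
    partitionFun h (glue F H) = tpair (ph h F) (ph h H) := by
  classical
  rw [glue, dif_pos (card_glueInc F H), tpair_ph, partitionFun]
  simp only
  let π : Fin F.ne ⊕ Fin H.ne → Fin (glueNE F H) :=
    fun x => (glueEquiv F H).symm (Quotient.mk _ x)
  have hπ : ∀ c, ∃ x, π x = c := fun c => by
    obtain ⟨x, hx⟩ := Quotient.exists_rep (glueEquiv F H c)
    exact ⟨x, by simp only [π, hx, Equiv.symm_apply_apply]⟩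
  refine Finset.sum_bij (fun ψ _ => (fun e => ψ (π (.inl e)), fun e => ψ (π (.inr e))))
    ?_ ?_ ?_ ?_
  · intro ψ _
    simp only [Finset.mem_filter_univ]
    funext j
    exact congrArg ψ (congrArg (glueEquiv F H).symm (Quotient.sound (glueSetoid_labelEdge F H j)))
  · intro ψ _ ψ' _ he
    rw [Prod.mk.injEq] at he
    funext c
    obtain ⟨x | x, rfl⟩ := hπ c
    exacts [congrFun he.1 x, congrFun he.2 x]
  · rintro ⟨χ, χ'⟩ hχ
    simp only [Finset.mem_filter_univ] at hχ
    have hlift : ∀ x y, glueSetoid F H x y → Sum.elim χ χ' x = Sum.elim χ χ' y :=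
      fun x y hxy => glueSetoid_le F H (Setoid.ker (Sum.elim χ χ')) (fun j => congrFun hχ j) hxy
    refine ⟨fun c => Quotient.lift (Sum.elim χ χ') hlift (glueEquiv F H c), Finset.mem_univ _, ?_⟩
    simp [π]
  · intro ψ _
    rw [Fin.prod_univ_add]
    congr 1
    · refine Finset.prod_congr rfl fun v _ => ?_
      congr 1
      simp only [monomialAt]
      rw [prod_pow_count_glueInc F H (fun c => (MvPolynomial.X (ψ c) : MvPolynomial (Fin n) 𝔽))]
      simp [Fintype.prod_sum_type, count_intEnds_inl, count_intEnds_inr_castAdd, π]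
    · refine Finset.prod_congr rfl fun v _ => ?_
      congr 1
      simp only [monomialAt]
      rw [prod_pow_count_glueInc F H (fun c => (MvPolynomial.X (ψ c) : MvPolynomial (Fin n) 𝔽))]
      simp [Fintype.prod_sum_type, count_intEnds_inr, count_intEnds_inl_natAdd, π]

end Fragments

section TensorAction

variable {𝔽 : Type} [Field 𝔽] {n k : ℕ}

theorem tact_apply (g : Matrix (Fin n) (Fin n) 𝔽) (t : Tensor 𝔽 n k) (φ : Fin k → Fin n) :
    tact g k t φ = ∑ ψ, (∏ i, g (φ i) (ψ i)) * t ψ := rfl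

theorem tact_one (t : Tensor 𝔽 n k) : tact 1 k t = t := by
  classical
  funext φ
  rw [tact_apply, Finset.sum_eq_single φ]
  · simp
  · intro ψ _ hψ
    obtain ⟨i, hi⟩ := Function.ne_iff.1 hψ
    rw [Finset.prod_eq_zero (Finset.mem_univ i) (by simp [hi.symm]), zero_mul]
  · simp

/-- The standard form on tensors is invariant under the orthogonal group. -/
theorem tpair_tact {g : Matrix (Fin n) (Fin n) 𝔽} (hg : g ∈ orthSet 𝔽 n)
    (t s : Tensor 𝔽 n k) : tpair (tact g k t) (tact g k s) = tpair t s := by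
  classical
  have horth : ∀ ψ ψ' : Fin k → Fin n,
      ∑ φ : Fin k → Fin n, (∏ i, g (φ i) (ψ i)) * ∏ i, g (φ i) (ψ' i) =
        if ψ = ψ' then 1 else 0 := by
    intro ψ ψ'
    simp only [← Finset.prod_mul_distrib]
    have := Finset.prod_univ_sum (fun _ : Fin k => (Finset.univ : Finset (Fin n)))
      (fun i c => g c (ψ i) * g c (ψ' i))
    rw [Fintype.piFinset_univ] at this
    rw [← this]
    have h1 : ∀ i, ∑ c, g c (ψ i) * g c (ψ' i) = if ψ i = ψ' i then 1 else 0 := by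
      intro i
      have := congrFun (congrFun (show g.transpose * g = 1 from hg) (ψ i)) (ψ' i)
      rwa [Matrix.mul_apply, Matrix.one_apply] at this
    simp only [h1]
    split_ifs with h
    · simp [h]
    · obtain ⟨i, hi⟩ := Function.ne_iff.1 h
      exact Finset.prod_eq_zero (Finset.mem_univ i) (by simp [hi])
  simp only [tpair, tact_apply, Finset.sum_mul_sum]
  rw [Finset.sum_comm]
  refine Finset.sum_congr rfl fun ψ _ => ?_
  rw [Finset.sum_comm]
  rw [Finset.sum_eq_single ψ]
  · calc _ = (∑ φ : Fin k → Fin n, (∏ i, g (φ i) (ψ i)) * ∏ i, g (φ i) (ψ i)) * (t ψ * s ψ) := by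
          rw [Finset.sum_mul]
          exact Finset.sum_congr rfl fun _ _ => by ring
      _ = _ := by rw [horth]; simp
  · intro ψ' _ hψ'
    calc _ = (∑ φ : Fin k → Fin n, (∏ i, g (φ i) (ψ i)) * ∏ i, g (φ i) (ψ' i)) *
            (t ψ * s ψ') := by
          rw [Finset.sum_mul]
          exact Finset.sum_congr rfl fun _ _ => by ring
      _ = _ := by rw [horth, if_neg (Ne.symm hψ'), zero_mul]
  · simp

end TensorAction

section SpinModel

variable {𝔽 : Type} [Field 𝔽] {n k m : ℕ}

theorem spinModel_monomialAt (u : Fin m → (Fin n → 𝔽)) (a : Fin m → 𝔽) (F : Fragment k)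
    (χ : Fin F.ne → Fin n) (v : Fin F.nv) :
    spinModel u a (monomialAt F χ v) =
      ∑ i, a i * ∏ e, u i (χ e) ^ (F.inc e).count (Sum.inl v) := by
  simp [spinModel, monomialAt, LinearMap.sum_apply]

theorem tact_ph_spinModel (u : Fin m → (Fin n → 𝔽)) (a : Fin m → 𝔽) (F : Fragment k)
    (g : Matrix (Fin n) (Fin n) 𝔽) (φ : Fin k → Fin n) :
    tact g k (ph (spinModel u a) F) φ = ∑ σ : Fin F.nv → Fin m, (∏ v, a (σ v)) *
      ∏ e, ∑ c, ((F.inc e).map (Sum.elim (fun v => u (σ v) c) (fun j => g (φ j) c))).prod := by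
  classical
  have h1 : tact g k (ph (spinModel u a) F) φ = ∑ χ : Fin F.ne → Fin n,
      (∏ j, g (φ j) (χ (F.labelEdge j))) * ∏ v, spinModel u a (monomialAt F χ v) := by
    simp only [tact_apply, ph, hphi_eq_sum_ite, Finset.mul_sum]
    rw [Finset.sum_comm]
    refine Finset.sum_congr rfl fun χ _ => ?_
    rw [Finset.sum_eq_single (fun j => χ (F.labelEdge j))]
    · simp
    · intro ψ _ hψ
      rw [if_neg (Ne.symm hψ), mul_zero]
    · simp
  have h2 : ∀ χ : Fin F.ne → Fin n, ∏ v, spinModel u a (monomialAt F χ v) =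
      ∑ σ : Fin F.nv → Fin m, (∏ v, a (σ v)) *
        ∏ e, ∏ v, u (σ v) (χ e) ^ (F.inc e).count (Sum.inl v) := by
    intro χ
    simp only [spinModel_monomialAt]
    rw [Finset.prod_univ_sum, Fintype.piFinset_univ]
    refine Finset.sum_congr rfl fun σ _ => ?_
    rw [Finset.prod_mul_distrib, Finset.prod_comm]
  have h3 : ∀ σ : Fin F.nv → Fin m,
      (∏ e, ∑ c, ((F.inc e).map
        (Sum.elim (fun v => u (σ v) c) (fun j => g (φ j) c))).prod) =
      ∑ χ : Fin F.ne → Fin n, (∏ j, g (φ j) (χ (F.labelEdge j))) *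
        ∏ e, ∏ v, u (σ v) (χ e) ^ (F.inc e).count (Sum.inl v) := by
    intro σ
    rw [Finset.prod_univ_sum, Fintype.piFinset_univ]
    refine Finset.sum_congr rfl fun χ _ => ?_
    have h4 : ∏ j, g (φ j) (χ (F.labelEdge j)) =
        ∏ e, ∏ j, g (φ j) (χ e) ^ (F.inc e).count (Sum.inr j) := by
      rw [Finset.prod_comm]
      refine Finset.prod_congr rfl fun j _ => ?_
      simp [F.count_inr]
    rw [h4, ← Finset.prod_mul_distrib]
    refine Finset.prod_congr rfl fun e _ => ?_
    rw [Finset.prod_multiset_map_count, mul_comm,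
      Finset.prod_subset (Finset.subset_univ _), Fintype.prod_sum_type]
    · simp
    · intro x _ hx
      rw [Multiset.count_eq_zero_of_notMem (by simpa using hx), pow_zero]
  simp only [h1, h2, h3, Finset.mul_sum]
  rw [Finset.sum_comm]
  exact Finset.sum_congr rfl fun σ _ => Finset.sum_congr rfl fun χ _ => by ring

theorem ph_spinModel (u : Fin m → (Fin n → 𝔽)) (a : Fin m → 𝔽) (F : Fragment k)
    (φ : Fin k → Fin n) :
    ph (spinModel u a) F φ = ∑ σ : Fin F.nv → Fin m, (∏ v, a (σ v)) *
      ∏ e, ∑ c, ((F.inc e).map (Sum.elim (fun v => u (σ v) c)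
        (fun j => (1 : Matrix (Fin n) (Fin n) 𝔽) (φ j) c))).prod := by
  rw [← tact_ph_spinModel, tact_one]

/-- The orthogonal matrices permuting the vectors `u i` and preserving the weights `a i`. -/
def spinStab (u : Fin m → (Fin n → 𝔽)) (a : Fin m → 𝔽) : Set (Matrix (Fin n) (Fin n) 𝔽) :=
  {g | g ∈ orthSet 𝔽 n ∧ ∀ i, ∃ j, g.mulVec (u i) = u j ∧ a j = a i}

theorem dotProduct_mulVec_mulVec {g : Matrix (Fin n) (Fin n) 𝔽} (hg : g ∈ orthSet 𝔽 n)
    (x y : Fin n → 𝔽) : (g.mulVec x) ⬝ᵥ (g.mulVec y) = x ⬝ᵥ y := by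
  rw [Matrix.dotProduct_mulVec, Matrix.vecMul_mulVec, show g.transpose * g = 1 from hg,
    Matrix.vecMul_one]

theorem ph_mem_invSub {u : Fin m → (Fin n → 𝔽)} (hu : Function.Injective u) (a : Fin m → 𝔽)
    (F : Fragment k) : ph (spinModel u a) F ∈ invSub (spinStab u a) k := by
  rintro g ⟨hg, hperm⟩
  choose w hw hwa using hperm
  have hginj : Function.Injective g.mulVec := by
    refine Function.LeftInverse.injective (g := g.transpose.mulVec) fun x => ?_
    rw [Matrix.mulVec_mulVec, show g.transpose * g = 1 from hg, Matrix.one_mulVec]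
  have hwbij : Function.Bijective w := by
    rw [← Finite.injective_iff_bijective]
    intro i j hij
    exact hu (hginj (by rw [hw, hw, hij]))
  have hg' : g * g.transpose = 1 := mul_eq_one_comm.1 hg
  funext φ
  rw [tact_ph_spinModel, ph_spinModel]
  refine Fintype.sum_equiv (Equiv.arrowCongr (Equiv.refl _) (Equiv.ofBijective w hwbij)) _ _
    fun σ => ?_
  have hval : ∀ v, (Equiv.arrowCongr (Equiv.refl _) (Equiv.ofBijective w hwbij)) σ v = w (σ v) :=
    fun v => rfl
  simp only [hval, hwa]
  congr 1
  refine Finset.prod_congr rfl fun e _ => ?_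
  have hvec : ∀ x : Fin F.nv ⊕ Fin k,
      (fun c => Sum.elim (fun v => u (w (σ v)) c)
        (fun j => (1 : Matrix (Fin n) (Fin n) 𝔽) (φ j) c) x) =
      g.mulVec (fun c => Sum.elim (fun v => u (σ v) c) (fun j => g (φ j) c) x) := by
    rintro (v | j)
    · simpa using (hw (σ v)).symm
    · funext c
      have := congrFun (congrFun hg' c) (φ j)
      rw [Matrix.mul_apply] at this
      simp only [Sum.elim_inr, Matrix.mulVec, dotProduct]
      simp only [Matrix.transpose_apply] at this
      rw [this, Matrix.one_apply, Matrix.one_apply]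
      simp only [eq_comm]
  rcases F.card_inc e with h | h
  · obtain ⟨x, y, hxy⟩ := Multiset.card_eq_two.1 h
    simp only [hxy, Multiset.insert_eq_cons, Multiset.map_cons, Multiset.map_singleton,
      Multiset.prod_cons, Multiset.prod_singleton]
    have := dotProduct_mulVec_mulVec hg
      (fun c => Sum.elim (fun v => u (σ v) c) (fun j => g (φ j) c) x)
      (fun c => Sum.elim (fun v => u (σ v) c) (fun j => g (φ j) c) y)
    rw [← hvec, ← hvec] at this
    exact this.symm
  · rw [Multiset.card_eq_zero.1 h]
    simp

/-- The fragment with `N` vertices, edge list `l`, and an open end attached to each `c j`. -/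
def listFragment {N : ℕ} (c : Fin k → Fin N) (l : List (Fin N × Fin N)) : Fragment k where
  nv := N
  ne := l.length + k
  inc := Fin.addCases (fun e => {Sum.inl (l.get e).1, Sum.inl (l.get e).2})
    (fun j => {Sum.inl (c j), Sum.inr j})
  card_inc := fun e => Or.inl (by
    refine Fin.addCases (fun e => ?_) (fun j => ?_) e <;> simp)
  openEnd := fun j => by
    rw [Fin.sum_univ_add]
    simp [Multiset.count_singleton]

/-- The tensor `u (s 1) ⊗ ⋯ ⊗ u (s k)`. -/
def pureTensor (u : Fin m → (Fin n → 𝔽)) (s : Fin k → Fin m) : Tensor 𝔽 n k :=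
  fun φ => ∏ j, u (s j) (φ j)

theorem ph_listFragment (u : Fin m → (Fin n → 𝔽)) (a : Fin m → 𝔽) {N : ℕ}
    (c : Fin k → Fin N) (l : List (Fin N × Fin N)) :
    ph (spinModel u a) (listFragment c l) = ∑ σ : Fin N → Fin m,
      ((∏ v, a (σ v)) * (l.map fun p => u (σ p.1) ⬝ᵥ u (σ p.2)).prod) •
        pureTensor u (fun j => σ (c j)) := by
  funext φ
  rw [ph_spinModel, Finset.sum_apply]
  refine Finset.sum_congr rfl fun σ _ => ?_
  simp only [Pi.smul_apply, smul_eq_mul, mul_assoc]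
  congr 1
  refine (Fin.prod_univ_add (a := l.length) (b := k) _).trans ?_
  congr 1
  · rw [← Fin.prod_univ_fun_getElem]
    refine Finset.prod_congr rfl fun e _ => ?_
    simp [listFragment, dotProduct]
  · refine Finset.prod_congr rfl fun j _ => ?_
    simp [listFragment, Matrix.one_apply]

/-- The span of the tensors of `k`-fragments. -/
noncomputable def fragSpan (h : VertexModel 𝔽 n) (k : ℕ) : Submodule 𝔽 (Tensor 𝔽 n k) :=
  Submodule.span 𝔽 (Set.range fun F : Fragment k => ph h F)

theorem sum_eval_smul_mem_fragSpan (u : Fin m → (Fin n → 𝔽)) (a : Fin m → 𝔽) {N : ℕ}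
    (c : Fin k → Fin N) (P : MvPolynomial (Fin N × Fin N) 𝔽) :
    ∑ σ : Fin N → Fin m,
      ((∏ v, a (σ v)) * eval (fun p => u (σ p.1) ⬝ᵥ u (σ p.2)) P) •
        pureTensor u (fun j => σ (c j)) ∈ fragSpan (spinModel u a) k := by
  induction P using MvPolynomial.induction_on' with
  | monomial d r =>
    have := Submodule.smul_mem _ r (Submodule.subset_span (R := 𝔽)
      (Set.mem_range_self (f := fun F : Fragment k => ph (spinModel u a) F)
        (listFragment c (Finsupp.toMultiset d).toList)))
    refine (congrArg (· ∈ fragSpan (spinModel u a) k) ?_).mp this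
    simp only [ph_listFragment, Finset.smul_sum, smul_smul]
    refine Finset.sum_congr rfl fun σ _ => ?_
    congr 1
    rw [eval_monomial, ← Multiset.prod_coe, ← Multiset.map_coe, Multiset.coe_toList,
      Finsupp.toMultiset_map, Finsupp.prod_toMultiset]
    rw [Finsupp.prod_mapDomain_index (by simp) (by simp [pow_add])]
    ring
  | add P Q hP hQ =>
    have := Submodule.add_mem _ hP hQ
    simpa only [map_add, mul_add, add_smul, Finset.sum_add_distrib] using this

/-- Polynomials separate a point from the other points of a finite set. -/
theorem exists_eval_eq_ite {ι : Type*} (S : Finset (ι → 𝔽)) (p : ι → 𝔽) [DecidableEq (ι → 𝔽)] :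
    ∃ P : MvPolynomial ι 𝔽, ∀ x ∈ S, eval x P = if x = p then 1 else 0 := by
  have hq : ∀ q : ι → 𝔽, ∃ P : MvPolynomial ι 𝔽, q ≠ p → eval p P = 1 ∧ eval q P = 0 := by
    intro q
    by_cases h : q = p
    · exact ⟨0, fun h' => (h' h).elim⟩
    · obtain ⟨i, hi⟩ := Function.ne_iff.1 h
      refine ⟨C (p i - q i)⁻¹ * (X i - C (q i)), fun _ => ⟨?_, by simp⟩⟩
      have : p i - q i ≠ 0 := sub_ne_zero.2 (Ne.symm hi)
      simp [this]
  choose Q hQ using hq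
  refine ⟨∏ q ∈ S.erase p, Q q, fun x hx => ?_⟩
  rw [map_prod]
  split_ifs with h
  · subst h
    exact Finset.prod_eq_one fun q hq => (hQ q (Finset.ne_of_mem_erase hq)).1
  · exact Finset.prod_eq_zero (Finset.mem_erase.2 ⟨h, hx⟩) (hQ x h).2

theorem eq_of_dotProduct_eq {u : Fin m → (Fin n → 𝔽)}
    (hspan : Submodule.span 𝔽 (Set.range u) = ⊤) {x y : Fin n → 𝔽}
    (h : ∀ l, x ⬝ᵥ u l = y ⬝ᵥ u l) : x = y := by
  refine dotProduct_eq _ _ fun z => ?_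
  have hz : z ∈ Submodule.span 𝔽 (Set.range u) := hspan ▸ Submodule.mem_top
  induction hz using Submodule.span_induction with
  | mem z hz => obtain ⟨l, rfl⟩ := hz; exact h l
  | zero => simp
  | add z z' _ _ hz hz' => rw [dotProduct_add, dotProduct_add, hz, hz']
  | smul r z _ hz => rw [dotProduct_smul, dotProduct_smul, hz]

/-- `w` preserves the Gram matrix of `u`. -/
def GramPreserving (u : Fin m → (Fin n → 𝔽)) (w : Fin m → Fin m) : Prop :=
  ∀ i j, u (w i) ⬝ᵥ u (w j) = u i ⬝ᵥ u j

theorem GramPreserving.bijective {u : Fin m → (Fin n → 𝔽)} (hu : Function.Injective u)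
    (hspan : Submodule.span 𝔽 (Set.range u) = ⊤) {w : Fin m → Fin m}
    (hw : GramPreserving u w) : Function.Bijective w := by
  rw [← Finite.injective_iff_bijective]
  intro i j hij
  refine hu (eq_of_dotProduct_eq hspan fun l => ?_)
  rw [← hw, hij, hw]

theorem GramPreserving.exists_orthogonal {u : Fin m → (Fin n → 𝔽)} (hu : Function.Injective u)
    (hspan : Submodule.span 𝔽 (Set.range u) = ⊤) {w : Fin m → Fin m}
    (hw : GramPreserving u w) : ∃ g ∈ orthSet 𝔽 n, ∀ i, g.mulVec (u i) = u (w i) := by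
  classical
  obtain ⟨r, hr⟩ := (Fintype.linearCombination 𝔽 u).exists_rightInverse_of_surjective
    (by rw [Fintype.range_linearCombination, hspan])
  let g : Matrix (Fin n) (Fin n) 𝔽 :=
    LinearMap.toMatrix' ((Fintype.linearCombination 𝔽 (fun i => u (w i))).comp r)
  have hg : ∀ i, g.mulVec (u i) = u (w i) := by
    intro i
    refine eq_of_dotProduct_eq hspan fun l => ?_
    obtain ⟨l, rfl⟩ := (hw.bijective hu hspan).2 l
    have h1 : g.mulVec (u i) = ∑ j, r (u i) j • u (w j) := by
      rw [LinearMap.toMatrix'_mulVec]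
      rfl
    have h2 : u i = ∑ j, r (u i) j • u j := (LinearMap.congr_fun hr (u i)).symm
    rw [h1, hw, sum_dotProduct]
    conv_rhs => rw [h2, sum_dotProduct]
    simp only [smul_dotProduct, hw _ l]
  refine ⟨g, ?_, hg⟩
  have key : ∀ x y, g.mulVec x ⬝ᵥ g.mulVec y = x ⬝ᵥ y := by
    intro x y
    have hx : x ∈ Submodule.span 𝔽 (Set.range u) := hspan ▸ Submodule.mem_top
    have hy : y ∈ Submodule.span 𝔽 (Set.range u) := hspan ▸ Submodule.mem_top
    induction hx, hy using Submodule.span_induction₂ with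
    | mem_mem x y hx hy =>
      obtain ⟨i, rfl⟩ := hx
      obtain ⟨j, rfl⟩ := hy
      rw [hg, hg, hw]
    | zero_left y _ => simp
    | zero_right x _ => simp
    | add_left x y z _ _ _ h h' => rw [Matrix.mulVec_add, add_dotProduct, add_dotProduct, h, h']
    | add_right x y z _ _ _ h h' => rw [Matrix.mulVec_add, dotProduct_add, dotProduct_add, h, h']
    | smul_left r x y _ _ h => rw [Matrix.mulVec_smul, smul_dotProduct, smul_dotProduct, h]
    | smul_right r x y _ _ h => rw [Matrix.mulVec_smul, dotProduct_smul, dotProduct_smul, h]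
  change g.transpose * g = 1
  ext i j
  have := key (Pi.single i 1) (Pi.single j 1)
  rw [Matrix.mulVec_single_one, Matrix.mulVec_single_one] at this
  rw [Matrix.mul_apply, Matrix.one_apply]
  refine this.trans ?_
  simp [Pi.single_apply, eq_comm]

theorem tact_pureTensor {u : Fin m → (Fin n → 𝔽)} {g : Matrix (Fin n) (Fin n) 𝔽}
    {w : Fin m → Fin m} (hg : ∀ i, g.mulVec (u i) = u (w i)) (s : Fin k → Fin m) :
    tact g k (pureTensor u s) = pureTensor u (fun j => w (s j)) := by
  funext φ
  simp only [tact_apply, pureTensor, ← Finset.prod_mul_distrib, ← hg, Matrix.mulVec, dotProduct]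
  rw [Finset.prod_univ_sum, Fintype.piFinset_univ]

theorem span_pureTensor {u : Fin m → (Fin n → 𝔽)}
    (hspan : Submodule.span 𝔽 (Set.range u) = ⊤) :
    Submodule.span 𝔽 (Set.range (pureTensor (k := k) u)) = ⊤ := by
  classical
  have hsurj : ∀ c : Fin n, ∃ r : Fin m → 𝔽, ∑ i, r i • u i = Pi.single c 1 := by
    intro c
    have : Pi.single c 1 ∈ Submodule.span 𝔽 (Set.range u) := hspan ▸ Submodule.mem_top
    exact (Submodule.mem_span_range_iff_exists_fun 𝔽).1 this
  choose r hr using hsurj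
  rw [eq_top_iff, ← (Pi.basisFun 𝔽 (Fin k → Fin n)).span_eq, Submodule.span_le]
  rintro _ ⟨φ, rfl⟩
  have : Pi.basisFun 𝔽 (Fin k → Fin n) φ =
      ∑ s : Fin k → Fin m, (∏ j, r (φ j) (s j)) • pureTensor u s := by
    funext ψ
    simp only [Finset.sum_apply, Pi.smul_apply, pureTensor, smul_eq_mul,
      ← Finset.prod_mul_distrib]
    have h2 := Finset.prod_univ_sum (fun _ : Fin k => (Finset.univ : Finset (Fin m)))
      (fun j i => r (φ j) i * u i (ψ j))
    rw [Fintype.piFinset_univ] at h2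
    rw [← h2]
    have h3 : ∀ j, ∑ i, r (φ j) i * u i (ψ j) = if ψ j = φ j then 1 else 0 := by
      intro j
      have := congrFun (hr (φ j)) (ψ j)
      simpa [Finset.sum_apply, Pi.single_apply] using this
    simp only [h3, Pi.basisFun_apply, Pi.single_apply]
    split_ifs with h
    · simp [h]
    · obtain ⟨j, hj⟩ := Function.ne_iff.1 h
      exact (Finset.prod_eq_zero (Finset.mem_univ j) (by simp [hj])).symm
  rw [this]
  exact Submodule.sum_mem _ fun s _ => Submodule.smul_mem _ _ (Submodule.subset_span ⟨s, rfl⟩)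

/-- The weighted orbit sums of a pure tensor under Gram preserving maps come from fragments. -/
theorem sum_pow_smul_mem_fragSpan {u : Fin m → (Fin n → 𝔽)} (hu : Function.Injective u)
    (hspan : Submodule.span 𝔽 (Set.range u) = ⊤) (a : Fin m → 𝔽) (s : Fin k → Fin m)
    (d : Fin m → ℕ) [DecidablePred (GramPreserving u)] :
    ∑ w : Fin m → Fin m with GramPreserving u w,
      (∏ i, a (w i) ^ (d i + 1)) • pureTensor u (fun j => w (s j)) ∈
        fragSpan (spinModel u a) k := by
  classical
  let T := Σ i : Fin m, Fin (d i + 1)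
  let e : T ≃ Fin (Fintype.card T) := Fintype.equivFin T
  let τ : Fin (Fintype.card T) → Fin m := fun v => (e.symm v).1
  let sec : Fin m → Fin (Fintype.card T) := fun i => e ⟨i, 0⟩
  have hsec : ∀ i, τ (sec i) = i := fun i => by simp [τ, sec]
  let G : (Fin (Fintype.card T) → Fin m) →
      (Fin (Fintype.card T) × Fin (Fintype.card T)) → 𝔽 := fun σ p => u (σ p.1) ⬝ᵥ u (σ p.2)
  obtain ⟨P, hP⟩ := exists_eval_eq_ite (Finset.univ.image G) (G τ)
  have hmem := sum_eval_smul_mem_fragSpan u a (fun j => sec (s j)) P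
  refine (congrArg (· ∈ fragSpan (spinModel u a) k) ?_).mp hmem
  have hP' : ∀ σ, eval (fun p => u (σ p.1) ⬝ᵥ u (σ p.2)) P = if G σ = G τ then 1 else 0 :=
    fun σ => hP (G σ) (Finset.mem_image_of_mem _ (Finset.mem_univ _))
  simp only [hP', mul_ite, mul_one, mul_zero, ite_smul, zero_smul]
  rw [← Finset.sum_filter]
  symm
  refine Finset.sum_bij (fun w _ v => w (τ v)) ?_ ?_ ?_ ?_
  · intro w hw
    simp only [Finset.mem_filter_univ] at hw ⊢
    exact funext fun p => hw _ _
  · intro w _ w' _ h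
    funext i
    simpa [hsec] using congrFun h (sec i)
  · intro σ hσ
    simp only [Finset.mem_filter_univ] at hσ
    have hG : ∀ v v', u (σ v) ⬝ᵥ u (σ v') = u (τ v) ⬝ᵥ u (τ v') := fun v v' =>
      congrFun hσ (v, v')
    have hw : GramPreserving u (fun i => σ (sec i)) := fun i j => by
      rw [hG, hsec, hsec]
    refine ⟨fun i => σ (sec i), by simpa using hw, ?_⟩
    funext v
    refine hu (eq_of_dotProduct_eq hspan fun l => ?_)
    obtain ⟨l, rfl⟩ := (hw.bijective hu hspan).2 l
    simp only [hG, hsec]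
  · intro w _
    congr 1
    · rw [← Equiv.prod_comp e, Fintype.prod_sigma]
      simp [τ]
    · simp only [hsec]

/-- `w` preserves the Gram matrix of `u` and the weights `a`. -/
def WeightedGramPreserving (u : Fin m → (Fin n → 𝔽)) (a : Fin m → 𝔽) (w : Fin m → Fin m) : Prop :=
  GramPreserving u w ∧ ∀ i, a (w i) = a i

theorem sum_pureTensor_mem_fragSpan {u : Fin m → (Fin n → 𝔽)} (hu : Function.Injective u)
    (hspan : Submodule.span 𝔽 (Set.range u) = ⊤) {a : Fin m → 𝔽} (ha : ∀ i, a i ≠ 0)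
    (s : Fin k → Fin m) [DecidablePred (WeightedGramPreserving u a)] :
    ∑ w : Fin m → Fin m with WeightedGramPreserving u a w, pureTensor u (fun j => w (s j)) ∈
        fragSpan (spinModel u a) k := by
  classical
  have hQ : ∀ Q : MvPolynomial (Fin m) 𝔽, ∑ w : Fin m → Fin m with GramPreserving u w,
      ((∏ i, a (w i)) * eval (fun i => a (w i)) Q) • pureTensor u (fun j => w (s j)) ∈
        fragSpan (spinModel u a) k := by
    intro Q
    induction Q using MvPolynomial.induction_on' with
    | monomial d r =>
      have := Submodule.smul_mem _ r (sum_pow_smul_mem_fragSpan hu hspan a s d)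
      refine (congrArg (· ∈ fragSpan (spinModel u a) k) ?_).mp this
      rw [Finset.smul_sum]
      refine Finset.sum_congr rfl fun w _ => ?_
      rw [smul_smul, eval_monomial, Finsupp.prod_fintype _ _ (by simp)]
      simp only [pow_succ, Finset.prod_mul_distrib]
      congr 1
      ring
    | add P Q hP hQ =>
      have := Submodule.add_mem _ hP hQ
      simpa only [map_add, mul_add, add_smul, Finset.sum_add_distrib] using this
  obtain ⟨Q, hQa⟩ := exists_eval_eq_ite
    (Finset.univ.image fun w : Fin m → Fin m => fun i => a (w i)) a
  have hmem := Submodule.smul_mem _ (∏ i, a i)⁻¹ (hQ Q)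
  refine (congrArg (· ∈ fragSpan (spinModel u a) k) ?_).mp hmem
  have hQ' : ∀ w : Fin m → Fin m, eval (fun i => a (w i)) Q =
      if (fun i => a (w i)) = a then 1 else 0 :=
    fun w => hQa _ (Finset.mem_image_of_mem _ (Finset.mem_univ w))
  have hfilter : (Finset.univ.filter fun w : Fin m → Fin m => WeightedGramPreserving u a w) =
      (Finset.univ.filter fun w : Fin m → Fin m => GramPreserving u w).filter
        fun w => (fun i => a (w i)) = a := by
    ext w
    simp only [Finset.mem_filter, Finset.mem_univ, true_and, funext_iff]
    exact Iff.rfl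
  rw [hfilter, Finset.smul_sum]
  conv_rhs => rw [Finset.sum_filter]
  refine Finset.sum_congr rfl fun w _ => ?_
  rw [hQ']
  split_ifs with h
  · have h' : ∏ i, a (w i) = ∏ i, a i := Finset.prod_congr rfl fun i _ => congrFun h i
    rw [h', mul_one, smul_smul, inv_mul_cancel₀ (Finset.prod_ne_zero_iff.2 fun i _ => ha i),
      one_smul]
  · simp

theorem WeightedGramPreserving.exists_mem_spinStab {u : Fin m → (Fin n → 𝔽)}
    (hu : Function.Injective u) (hspan : Submodule.span 𝔽 (Set.range u) = ⊤) {a : Fin m → 𝔽}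
    {w : Fin m → Fin m} (hw : WeightedGramPreserving u a w) :
    ∃ g ∈ spinStab u a, ∀ i, g.mulVec (u i) = u (w i) := by
  obtain ⟨g, hg, hgu⟩ := hw.1.exists_orthogonal hu hspan
  exact ⟨g, ⟨hg, fun i => ⟨w i, hgu i, hw.2 i⟩⟩, hgu⟩

theorem card_weightedGramPreserving_ne_zero [CharZero 𝔽] (u : Fin m → (Fin n → 𝔽))
    (a : Fin m → 𝔽) [DecidablePred (WeightedGramPreserving u a)] :
    ((Finset.univ.filter (WeightedGramPreserving u a)).card : 𝔽) ≠ 0 := by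
  rw [Nat.cast_ne_zero, Finset.card_ne_zero]
  exact ⟨id, by simp [WeightedGramPreserving, GramPreserving]⟩

theorem fragSpan_spinModel [CharZero 𝔽] {u : Fin m → (Fin n → 𝔽)} (hu : Function.Injective u)
    (hspan : Submodule.span 𝔽 (Set.range u) = ⊤) {a : Fin m → 𝔽} (ha : ∀ i, a i ≠ 0) :
    fragSpan (spinModel u a) k = invSub (spinStab u a) k := by
  classical
  refine le_antisymm (Submodule.span_le.2 ?_) fun t ht => ?_
  · rintro _ ⟨F, rfl⟩
    exact ph_mem_invSub hu a F
  · have hg : ∀ w, ∃ g, WeightedGramPreserving u a w →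
        g ∈ spinStab u a ∧ ∀ i, g.mulVec (u i) = u (w i) := by
      intro w
      by_cases hw : WeightedGramPreserving u a w
      · obtain ⟨g, hg⟩ := hw.exists_mem_spinStab hu hspan
        exact ⟨g, fun _ => hg⟩
      · exact ⟨0, fun h => (hw h).elim⟩
    choose g hg using hg
    have hsum : ∀ t : Tensor 𝔽 n k,
        ∑ w with WeightedGramPreserving u a w, tact (g w) k t ∈ fragSpan (spinModel u a) k := by
      intro t
      have ht : t ∈ Submodule.span 𝔽 (Set.range (pureTensor (k := k) u)) :=
        span_pureTensor hspan ▸ Submodule.mem_top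
      induction ht using Submodule.span_induction with
      | mem t ht =>
        obtain ⟨s, rfl⟩ := ht
        rw [Finset.sum_congr rfl fun w hw =>
          tact_pureTensor (hg w (Finset.mem_filter.1 hw).2).2 s]
        exact sum_pureTensor_mem_fragSpan hu hspan ha s
      | zero => simp
      | add t t' _ _ h h' =>
        simpa only [map_add, Finset.sum_add_distrib] using Submodule.add_mem _ h h'
      | smul r t _ h =>
        simpa only [map_smul, ← Finset.smul_sum] using Submodule.smul_mem _ r h
    have h := hsum t
    rw [Finset.sum_congr rfl fun w hw => ht (g w) (hg w (Finset.mem_filter.1 hw).2).1,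
      Finset.sum_const, ← Nat.cast_smul_eq_nsmul 𝔽] at h
    exact (Submodule.smul_mem_iff _ (card_weightedGramPreserving_ne_zero u a)).1 h

/-- Pairing with tensors, as a linear map in the first argument. -/
noncomputable def pairRow (h : VertexModel 𝔽 n) (k : ℕ) : Tensor 𝔽 n k →ₗ[𝔽] (Fragment k → 𝔽) where
  toFun t H := tpair t (ph h H)
  map_add' t t' := by
    funext H
    simp [tpair, add_mul, Finset.sum_add_distrib]
  map_smul' r t := by
    funext H
    simp [tpair, mul_assoc, Finset.mul_sum]

theorem tpair_eq_zero_of_forall_mem {t : Tensor 𝔽 n k} {S : Set (Tensor 𝔽 n k)}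
    (h : ∀ s ∈ S, tpair t s = 0) {s : Tensor 𝔽 n k} (hs : s ∈ Submodule.span 𝔽 S) :
    tpair t s = 0 := by
  induction hs using Submodule.span_induction with
  | mem s hs => exact h s hs
  | zero => simp [tpair]
  | add s s' _ _ hs hs' =>
    have : tpair t (s + s') = tpair t s + tpair t s' := by
      simp [tpair, mul_add, Finset.sum_add_distrib]
    rw [this, hs, hs', add_zero]
  | smul r s _ hs =>
    have : tpair t (r • s) = r * tpair t s := by
      simp [tpair, Finset.mul_sum, mul_left_comm]
    rw [this, hs, mul_zero]

/-- The standard form is nondegenerate on invariant tensors. -/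
theorem eq_zero_of_mem_invSub_of_pairRow_eq_zero [CharZero 𝔽] {u : Fin m → (Fin n → 𝔽)}
    (hu : Function.Injective u) (hspan : Submodule.span 𝔽 (Set.range u) = ⊤) {a : Fin m → 𝔽}
    (ha : ∀ i, a i ≠ 0) {t : Tensor 𝔽 n k} (ht : t ∈ invSub (spinStab u a) k)
    (h : pairRow (spinModel u a) k t = 0) : t = 0 := by
  classical
  have hA : ∀ s ∈ fragSpan (spinModel u a) k, tpair t s = 0 := fun s hs =>
    tpair_eq_zero_of_forall_mem (by rintro _ ⟨F, rfl⟩; exact congrFun h F) hs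
  have hpure : ∀ s, tpair t (pureTensor u s) = 0 := by
    intro s
    have h0 := hA _ (sum_pureTensor_mem_fragSpan hu hspan ha s)
    have h1 : tpair t (∑ w with WeightedGramPreserving u a w, pureTensor u (fun j => w (s j))) =
        ∑ w with WeightedGramPreserving u a w, tpair t (pureTensor u (fun j => w (s j))) := by
      simp only [tpair, Finset.sum_apply, Finset.mul_sum]
      exact Finset.sum_comm
    have h2 : ∀ w, WeightedGramPreserving u a w →
        tpair t (pureTensor u (fun j => w (s j))) = tpair t (pureTensor u s) := by
      intro w hw
      obtain ⟨g, hg, hgu⟩ := hw.exists_mem_spinStab hu hspan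
      rw [← tact_pureTensor hgu, ← tpair_tact hg.1 t (pureTensor u s), ht g hg]
    rw [h1, Finset.sum_congr rfl fun w hw => h2 w (Finset.mem_filter.1 hw).2,
      Finset.sum_const, nsmul_eq_mul] at h0
    exact (mul_eq_zero.1 h0).resolve_left (card_weightedGramPreserving_ne_zero u a)
  funext φ
  have := tpair_eq_zero_of_forall_mem (t := t) (by rintro _ ⟨s, rfl⟩; exact hpure s)
    (span_pureTensor hspan ▸ Submodule.mem_top :
      (Pi.single φ 1 : Tensor 𝔽 n k) ∈ Submodule.span 𝔽 (Set.range (pureTensor (k := k) u)))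
  simpa [tpair, Pi.single_apply] using this

theorem spinStab_finite {u : Fin m → (Fin n → 𝔽)}
    (hspan : Submodule.span 𝔽 (Set.range u) = ⊤) (a : Fin m → 𝔽) : (spinStab u a).Finite := by
  refine Set.Finite.of_finite_image (f := fun g i => g.mulVec (u i))
    ((Set.Finite.pi' fun _ : Fin m => Set.finite_range u).subset ?_) ?_
  · rintro _ ⟨g, hg, rfl⟩ i
    obtain ⟨j, hj, -⟩ := hg.2 i
    exact ⟨j, hj.symm⟩
  · intro g _ g' _ h
    have hlin : g.mulVecLin = g'.mulVecLin :=
      LinearMap.ext_on_range hspan fun i => congrFun h i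
    exact Matrix.mulVec_injective (congrArg DFunLike.coe hlin)

theorem connectionRank_spinModel [CharZero 𝔽] {u : Fin m → (Fin n → 𝔽)}
    (hu : Function.Injective u) (hspan : Submodule.span 𝔽 (Set.range u) = ⊤) {a : Fin m → 𝔽}
    (ha : ∀ i, a i ≠ 0) (k : ℕ) :
    connectionRank (spinModel u a) k = Module.finrank 𝔽 (invSub (spinStab u a) k) := by
  have hrows : (Set.range fun F : Fragment k => fun H : Fragment k =>
      partitionFun (spinModel u a) (glue F H)) =
      pairRow (spinModel u a) k '' Set.range fun F : Fragment k => ph (spinModel u a) F := by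
    rw [← Set.range_comp]
    congr 1
    funext F H
    exact partitionFun_glue _ F H
  have hA := fragSpan_spinModel hu hspan ha (k := k)
  have hrange : Submodule.span 𝔽 (Set.range fun F : Fragment k => fun H : Fragment k =>
      partitionFun (spinModel u a) (glue F H)) =
      LinearMap.range ((pairRow (spinModel u a) k).domRestrict (invSub (spinStab u a) k)) := by
    rw [hrows, Submodule.span_image, LinearMap.range_domRestrict, ← hA]
    rfl
  rw [connectionRank, hrange]
  refine LinearMap.finrank_range_of_inj ((injective_iff_map_eq_zero _).2 fun t ht => ?_)
  exact Subtype.ext (eq_zero_of_mem_invSub_of_pairRow_eq_zero hu hspan ha t.2 ht)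

end SpinModel

end VertexModels


/-- **Corollary 15**: if the distinct points `u_1, …, u_m` span `V` and the
`aᵢ` are nonzero, then for `h(p) = ∑ᵢ aᵢ p(uᵢ)` the group `H` of orthogonal
transformations permuting the `uᵢ` compatibly with the `aᵢ` is finite, and
`rk(M_{f_h,k}) = dim (V^{⊗k})^H` for all `k`. -/
theorem spin_model_rank (𝔽 : Type) [Field 𝔽] [IsAlgClosed 𝔽] [CharZero 𝔽]
    (n m : ℕ) (u : Fin m → (Fin n → 𝔽)) (hu : Function.Injective u)
    (hspan : Submodule.span 𝔽 (Set.range u) = ⊤)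
    (a : Fin m → 𝔽) (ha : ∀ i, a i ≠ 0) :
    Set.Finite {g | g ∈ orthSet 𝔽 n ∧
        ∀ i, ∃ j, g.mulVec (u i) = u j ∧ a j = a i} ∧
    ∀ k : ℕ, connectionRank (spinModel u a) k
      = Module.finrank 𝔽 (invSub
          {g | g ∈ orthSet 𝔽 n ∧ ∀ i, ∃ j, g.mulVec (u i) = u j ∧ a j = a i} k) := by
  exact ⟨spinStab_finite hspan a, connectionRank_spinModel hu hspan ha⟩
end
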